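/- arXiv:1803.05703 — 2 statements merged into one kernel-verified Lean document; each statement's English description precedes it below -/
import Mathlib

section
/- For every ε > 0 there is a constant C = C(ε) > 0, independent of h, with the following property. Let h ≥ 1 be an integer and set K = ⌊ε·h·log 4⌋ with K ≥ 1. Let ψ: ℕ → ℝ be such that for every integer n with 2^{4^h} ≤ n < 2^{4^{h+1}} either ψ(n) = 0 or 1/n ≤ ψ(n) ≤ 1/2. For k ≥ 1 let ψ_k(n) = ψ(n)/e^k. Then there exists k ∈ {1, …, K} such that ∑_{2^{4^h} ≤ m < n < 2^{4^{h+1}}} λ(E_m(ψ_k) ∩ E_n(ψ_k)) ≤ C · ∑_{2^{4^h} ≤ m < n < 2^{4^{h+1}}} λ(E_m(ψ_k))·λ(E_n(ψ_k)). -/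
open MeasureTheory Filter Finset

/-- The set `E_n(ψ) ⊆ ℝ/ℤ`, the union over `1 ≤ a ≤ n`, `gcd(a,n)=1`, of the
intervals `((a-ψ(n))/n, (a+ψ(n))/n)` taken mod 1. -/
noncomputable def E (ψ : ℕ → ℝ) (n : ℕ) : Set UnitAddCircle :=
  ⋃ a ∈ (Finset.Icc 1 n).filter (fun a => Nat.Coprime a n),
    (fun y : ℝ => (y : UnitAddCircle)) '' Set.Ioo (((a : ℝ) - ψ n) / n) (((a : ℝ) + ψ n) / n)

/-- `W(ψ)`: points of the circle lying in infinitely many sets `E_n(ψ)`. -/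
noncomputable def W (ψ : ℕ → ℝ) : Set UnitAddCircle := {x | ∃ᶠ n in atTop, x ∈ E ψ n}

/-- `log x` understood as `max (1, log x)`. -/
noncomputable def flog (x : ℝ) : ℝ := max 1 (Real.log x)


noncomputable def rho (n : ℕ) : ℝ := ∏ p ∈ n.primeFactors, (1 - (p : ℝ)⁻¹)

lemma pf_pos {p : ℕ} (hp : p.Prime) : 0 < 1 - (p : ℝ)⁻¹ := by
  have : (1 : ℝ) < p := by exact_mod_cast hp.one_lt
  have := inv_lt_one_of_one_lt₀ this
  linarith

lemma pf_le {p : ℕ} : 1 - (p : ℝ)⁻¹ ≤ 1 := by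
  have : 0 ≤ (p : ℝ)⁻¹ := by positivity
  linarith

lemma pf_half {p : ℕ} (hp : p.Prime) : 1 / 2 ≤ 1 - (p : ℝ)⁻¹ := by
  have : (2 : ℝ) ≤ p := by exact_mod_cast hp.two_le
  have := inv_anti₀ (by norm_num) this
  linarith

lemma rho_pos (n : ℕ) : 0 < rho n :=
  Finset.prod_pos fun _ hp => pf_pos (Nat.prime_of_mem_primeFactors hp)

lemma rho_one : rho 1 = 1 := by simp [rho]

lemma rho_mul {m n : ℕ} (h : m.Coprime n) : rho (m * n) = rho m * rho n := by
  unfold rho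
  rw [h.primeFactors_mul, Finset.prod_union h.disjoint_primeFactors]

lemma sumLambda (M : ℕ) : ∑ d ∈ Ioc 0 M, ArithmeticFunction.vonMangoldt d / d ≤ 2 * Real.log M := by
  rcases Nat.eq_zero_or_pos M with rfl | hM
  · simp
  have h1 := ArithmeticFunction.sum_Ioc_mul_zeta_eq_sum ArithmeticFunction.vonMangoldt M
  rw [ArithmeticFunction.vonMangoldt_mul_zeta] at h1
  have h2 : ∑ n ∈ Ioc 0 M, ArithmeticFunction.log n ≤ M * Real.log M := by
    calc _ ≤ ∑ n ∈ Ioc 0 M, Real.log M := by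
          apply Finset.sum_le_sum
          intro i hi
          simp only [mem_Ioc] at hi
          simp only [ArithmeticFunction.log_apply]
          apply Real.log_le_log
          · exact_mod_cast hi.1
          · exact_mod_cast hi.2
      _ = _ := by simp
  have h3 : ∀ d ∈ Ioc 0 M, (M : ℝ) / 2 * (ArithmeticFunction.vonMangoldt d / d) ≤
      ArithmeticFunction.vonMangoldt d * ((M / d : ℕ) : ℝ) := by
    intro d hd
    simp only [mem_Ioc] at hd
    have hv : 0 ≤ ArithmeticFunction.vonMangoldt d := ArithmeticFunction.vonMangoldt_nonneg
    have hd0 : (0 : ℝ) < d := by exact_mod_cast hd.1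
    have h5 : (M : ℝ) / d / 2 ≤ ((M / d : ℕ) : ℝ) := by
      have h6 : 1 ≤ M / d := (Nat.one_le_div_iff hd.1).2 hd.2
      have h7 : M < (M / d + 1) * d := Nat.lt_mul_of_div_lt (Nat.lt_succ_self _) hd.1
      have h8 : (M : ℝ) < ((M / d : ℕ) + 1) * d := by exact_mod_cast h7
      have h9 : (1 : ℝ) ≤ ((M / d : ℕ) : ℝ) := by exact_mod_cast h6
      have : (M : ℝ) / d ≤ ((M / d : ℕ) + 1) := by
        rw [div_le_iff₀ hd0]; exact h8.le
      linarith
    calc _ = ArithmeticFunction.vonMangoldt d * ((M : ℝ) / d / 2) := by ring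
      _ ≤ _ := by gcongr
  have h4 := Finset.sum_le_sum h3
  rw [← Finset.mul_sum] at h4
  have hM' : (0 : ℝ) < M := by exact_mod_cast hM
  have h10 : (M : ℝ) / 2 * ∑ d ∈ Ioc 0 M, ArithmeticFunction.vonMangoldt d / d ≤ (M : ℝ) / 2 * (2 * Real.log M) := by
    calc _ ≤ _ := h4
      _ = _ := h1.symm
      _ ≤ _ := h2
      _ = _ := by ring
  exact le_of_mul_le_mul_left h10 (by positivity)

noncomputable def PP (M : ℕ) : ℝ := ∏ p ∈ Nat.primesLE M, (1 - (p : ℝ)⁻¹)⁻¹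

lemma PP_pos (M : ℕ) : 0 < PP M :=
  Finset.prod_pos fun _ hp => inv_pos.2 (pf_pos (Nat.prime_of_mem_primesLE hp))

lemma one_le_pfinv {p : ℕ} (hp : p.Prime) : 1 ≤ (1 - (p : ℝ)⁻¹)⁻¹ :=
  (one_le_inv₀ (pf_pos hp)).2 pf_le

lemma PP_mono {M M' : ℕ} (h : M ≤ M') : PP M ≤ PP M' := by
  apply Finset.prod_le_prod_of_subset_of_one_le
  · intro p hp
    rw [Nat.mem_primesLE] at hp ⊢
    exact ⟨hp.1.trans h, hp.2⟩
  · intro p hp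
    exact (inv_pos.2 (pf_pos (Nat.prime_of_mem_primesLE hp))).le
  · intro p hp _
    exact one_le_pfinv (Nat.prime_of_mem_primesLE hp)

lemma sumPrimeLog (M : ℕ) : ∑ p ∈ Nat.primesLE M, Real.log p / p ≤ 2 * Real.log M := by
  refine le_trans ?_ (sumLambda M)
  calc _ = ∑ p ∈ Nat.primesLE M, ArithmeticFunction.vonMangoldt p / p := by
        apply Finset.sum_congr rfl
        intro p hp
        rw [ArithmeticFunction.vonMangoldt_apply_prime (Nat.prime_of_mem_primesLE hp)]
    _ ≤ _ := by
        apply Finset.sum_le_sum_of_subset_of_nonneg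
        · intro p hp
          rw [Nat.mem_primesLE] at hp
          simp [hp.1, hp.2.pos]
        · intro i _ _
          exact div_nonneg ArithmeticFunction.vonMangoldt_nonneg (by positivity)

lemma zetaEuler (s : ℝ) (hs : 1 < s) (M : ℕ) :
    ∏ p ∈ Nat.primesLE M, (1 - (p : ℝ) ^ (-s))⁻¹ ≤ ∑' n : ℕ, 1 / (n : ℝ) ^ s := by
  have hsum : Summable (fun n : ℕ => 1 / (n : ℝ) ^ s) := Real.summable_one_div_nat_rpow.2 hs
  let f : ℕ →* ℝ :=
    { toFun := fun n => (n : ℝ) ^ (-s)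
      map_one' := by simp
      map_mul' := by
        intro a b
        push_cast
        rw [Real.mul_rpow (by positivity) (by positivity)] }
  have hf : ∀ n : ℕ, f n = 1 / (n : ℝ) ^ s := by
    intro n
    show (n : ℝ) ^ (-s) = _
    rw [Real.rpow_neg (by positivity), one_div]
  have hsum' : Summable (f : ℕ → ℝ) := by
    simpa [funext hf] using hsum
  have h := EulerProduct.prod_filter_prime_geometric_eq_tsum_factoredNumbers hsum' (Finset.range (M + 1))
  have h2 : ∏ p ∈ Nat.primesLE M, (1 - (p : ℝ) ^ (-s))⁻¹ =
    ∏ p ∈ Finset.range (M + 1) with p.Prime, (1 - f p)⁻¹ := by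
    rw [Nat.primesLE_eq_filter_range]; rfl
  rw [h2, h]
  have h3 : ∑' n : ℕ, 1 / (n : ℝ) ^ s = ∑' n : ℕ, f n := by simp_rw [hf]
  rw [h3]
  exact Summable.tsum_subtype_le f _ (fun n => by rw [hf]; positivity) hsum'

lemma mertens : ∃ C : ℝ, 0 < C ∧ ∀ M : ℕ, 4 ≤ M → PP M ≤ C * Real.log M := by
  have h1 := tendsto_sub_mul_tsum_nat_rpow
  have h2 : ∀ᶠ s : ℝ in nhdsWithin 1 (Set.Ioi 1), (s - 1) * ∑' (n : ℕ), 1 / (n : ℝ) ^ s < 2 :=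
    h1.eventually (gt_mem_nhds (by norm_num))
  have h3 : Tendsto (fun M : ℕ => 1 + 1 / Real.log M) atTop (nhdsWithin 1 (Set.Ioi 1)) := by
    rw [tendsto_nhdsWithin_iff]
    constructor
    · have : Tendsto (fun M : ℕ => 1 / Real.log M) atTop (nhds 0) := by
        simp only [one_div]
        exact (Real.tendsto_log_atTop.comp tendsto_natCast_atTop_atTop).inv_tendsto_atTop
      simpa using this.const_add 1
    · filter_upwards [eventually_ge_atTop 2] with M hM
      have : 0 < Real.log M := Real.log_pos (by exact_mod_cast hM)
      simp only [Set.mem_Ioi]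
      have : 0 < 1 / Real.log M := by positivity
      linarith
  obtain ⟨M0, hM0⟩ := eventually_atTop.1 (h3.eventually h2)
  have key : ∀ M : ℕ, 4 ≤ M → M0 ≤ M → PP M ≤ (Real.exp 4 * 2) * Real.log M := by
    intro M hM hM'
    have hl : 0 < Real.log M := Real.log_pos (by exact_mod_cast (by omega : 1 < M))
    set s : ℝ := 1 + 1 / Real.log M with hs
    have hs1 : 1 < s := by
      have : 0 < 1 / Real.log M := by positivity
      linarith
    have h4 := hM0 M hM'
    have h5 : ∑' (n : ℕ), 1 / (n : ℝ) ^ s ≤ 2 * Real.log M := by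
      have : (s - 1) = 1 / Real.log M := by rw [hs]; ring
      rw [← hs, this, one_div, inv_mul_lt_iff₀ hl] at h4
      linarith
    have h6 : PP M ≤ ∏ p ∈ Nat.primesLE M, (Real.exp (2 * (1 / Real.log M) * (Real.log p / p)) *
        (1 - (p : ℝ) ^ (-s))⁻¹) := by
      apply Finset.prod_le_prod
      · intro p hp
        exact (inv_pos.2 (pf_pos (Nat.prime_of_mem_primesLE hp))).le
      · intro p hp
        have hp' := Nat.prime_of_mem_primesLE hp
        have hp0 : (0 : ℝ) < p := by exact_mod_cast hp'.pos
        have hp1 : (1 : ℝ) < p := by exact_mod_cast hp'.one_lt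
        have hq : (p : ℝ) ^ (-s) = (p : ℝ)⁻¹ * Real.exp (-(1 / Real.log M * Real.log p)) := by
          rw [Real.rpow_def_of_pos hp0, ← Real.exp_log (inv_pos.2 hp0), ← Real.exp_add, Real.log_inv, hs]
          congr 1
          ring
        have hq1 : (p : ℝ) ^ (-s) < 1 := Real.rpow_lt_one_of_one_lt_of_neg hp1 (by linarith)
        have ha := pf_pos hp'
        have hb := pf_half hp'
        set u := 1 / Real.log M * Real.log p with hu
        have hu0 : 0 ≤ u := by
          have := Real.log_nonneg hp1.le
          positivity
        have he := Real.add_one_le_exp (-u)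
        have he2 := Real.add_one_le_exp (2 * (1 / Real.log M) * (Real.log p / p))
        have hr : 2 * (1 / Real.log M) * (Real.log p / p) = 2 * u * (p : ℝ)⁻¹ := by
          rw [hu]; ring
        rw [hr] at he2 ⊢
        rw [← div_eq_mul_inv, inv_eq_one_div, div_le_div_iff₀ ha (by linarith), one_mul]
        have hi : 0 < (p : ℝ)⁻¹ := by positivity
        have e1 : 1 - (p : ℝ) ^ (-s) ≤ 1 - (p:ℝ)⁻¹ + (p:ℝ)⁻¹ * u := by
          rw [hq]; nlinarith
        have e2 : (2 * u * (p:ℝ)⁻¹ + 1) * (1 - (p:ℝ)⁻¹) ≤ Real.exp (2 * u * (p:ℝ)⁻¹) * (1 - (p:ℝ)⁻¹) := by gcongr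
        have e3 : 0 ≤ u * (p:ℝ)⁻¹ := by positivity
        nlinarith
    rw [Finset.prod_mul_distrib, ← Real.exp_sum, ← Finset.mul_sum] at h6
    refine h6.trans ?_
    have h7 := sumPrimeLog M
    have h8 := (zetaEuler s hs1 M).trans h5
    have h9 : 2 * (1 / Real.log M) * ∑ p ∈ Nat.primesLE M, Real.log p / p ≤ 4 := by
      calc _ ≤ 2 * (1 / Real.log M) * (2 * Real.log M) := by gcongr
        _ = 4 := by field_simp; norm_num
    rw [mul_assoc (Real.exp 4)]
    exact mul_le_mul (Real.exp_le_exp.2 h9) h8 (Finset.prod_nonneg fun p hp => inv_nonneg.2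
      (sub_nonneg.2 (Real.rpow_le_one_of_one_le_of_nonpos
        (by exact_mod_cast (Nat.prime_of_mem_primesLE hp).one_lt.le) (by linarith)))) (by positivity)
  refine ⟨max (Real.exp 4 * 2) (PP (max M0 4)), lt_max_of_lt_left (by positivity), ?_⟩
  intro M hM
  have hl1 : 1 ≤ Real.log M := by
    rw [Real.le_log_iff_exp_le (by exact_mod_cast (by omega))]
    have := Real.exp_one_lt_three
    have : (4 : ℝ) ≤ M := by exact_mod_cast hM
    linarith
  rcases le_total M0 M with h | h
  · refine (key M hM h).trans ?_
    gcongr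
    exact le_max_left _ _
  · calc PP M ≤ PP (max M0 4) := PP_mono (h.trans (le_max_left _ _))
      _ ≤ PP (max M0 4) * Real.log M := le_mul_of_one_le_right (PP_pos _).le hl1
      _ ≤ _ := by
        gcongr
        exact le_max_right _ _


noncomputable def FF (N M : ℕ) : ℝ := ∑ c ∈ (Ioc 0 M).filter (fun c => c.Coprime N), (rho c)⁻¹
noncomputable def GG (N M : ℕ) : ℝ := ∑ c ∈ (Ioc 0 M).filter (fun c => c.Coprime N), ((c : ℝ) * rho c)⁻¹

lemma FF_nonneg (N M : ℕ) : 0 ≤ FF N M := Finset.sum_nonneg fun c _ => (inv_pos.2 (rho_pos c)).le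
lemma GG_nonneg (N M : ℕ) : 0 ≤ GG N M := Finset.sum_nonneg fun c _ => by
  have := rho_pos c
  positivity

lemma telesum (M : ℕ) : ∑ p ∈ Nat.primesLE M, (1 : ℝ) / (p * (p - 1)) ≤ 1 := by
  have h1 : ∀ M : ℕ, ∑ p ∈ Finset.range M, (1 : ℝ) / ((p + 2 : ℕ) * ((p + 2 : ℕ) - 1)) = 1 - 1 / (M + 1) := by
    intro M
    induction M with
    | zero => simp
    | succ k ih =>
      rw [Finset.sum_range_succ, ih]
      push_cast
      rw [show ((k : ℝ) + 2 - 1) = k + 1 by ring, show ((k : ℝ) + 1 + 1) = k + 2 by ring]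
      field_simp
      ring
  calc _ ≤ ∑ p ∈ (Finset.range M).image (fun p : ℕ => p + 2), (1 : ℝ) / ((p : ℕ) * ((p : ℕ) - 1)) := by
        apply Finset.sum_le_sum_of_subset_of_nonneg
        · intro p hp
          rw [Nat.mem_primesLE] at hp
          simp only [mem_image, mem_range]
          have := hp.2.two_le
          exact ⟨p - 2, by omega, by omega⟩
        · intro p hp _
          simp only [mem_image, mem_range] at hp
          obtain ⟨q, _, rfl⟩ := hp
          push_cast
          have : (0 : ℝ) ≤ (q : ℝ) + 2 - 1 := by
            have : (0 : ℝ) ≤ q := by positivity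
            linarith
          positivity
    _ = 1 - 1 / (M + 1) := by
        rw [Finset.sum_image (by intro a _ b _ h; simpa using h)]
        exact h1 M
    _ ≤ 1 := by
        have : (0 : ℝ) ≤ 1 / (M + 1) := by positivity
        linarith

lemma GG_le (N M : ℕ) : GG N M ≤
    Real.exp 1 * ∏ p ∈ (Nat.primesLE M).filter (fun p => ¬ p ∣ N), (1 - (p : ℝ)⁻¹)⁻¹ := by
  set s := (Nat.primesLE M).filter (fun p => ¬ p ∣ N) with hs
  have hsp : s.filter Nat.Prime = s := by
    apply Finset.filter_true_of_mem
    intro p hp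
    exact Nat.prime_of_mem_primesLE (Finset.mem_filter.1 hp).1
  let f : ℕ → ℝ := fun n => ((n : ℝ) * rho n)⁻¹
  have hf0 : ∀ n, 0 ≤ f n := fun n => by
    have := rho_pos n
    positivity
  have hf1 : f 1 = 1 := by simp [f, rho_one]
  have hmul : ∀ {m n : ℕ}, Nat.Coprime m n → f (m * n) = f m * f n := by
    intro m n h
    simp only [f, rho_mul h]
    push_cast
    rw [← mul_inv]
    congr 1
    ring
  have hpow : ∀ {p : ℕ}, p.Prime → ∀ n : ℕ, f (p ^ (n + 1)) = (p : ℝ)⁻¹ * (1 - (p : ℝ)⁻¹)⁻¹ * ((p : ℝ)⁻¹) ^ n := by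
    intro p hp n
    simp only [f, rho, Nat.primeFactors_prime_pow (Nat.succ_ne_zero n) hp, Finset.prod_singleton]
    push_cast
    rw [mul_inv, pow_succ, mul_inv, inv_pow]
    ring
  have hx1 : ∀ {p : ℕ}, p.Prime → (p : ℝ)⁻¹ < 1 := fun hp => by
    have := pf_pos hp
    linarith
  have hsm : ∀ {p : ℕ}, p.Prime → Summable (fun n : ℕ => f (p ^ n)) := by
    intro p hp
    rw [← summable_nat_add_iff 1]
    simp_rw [hpow hp]
    exact (summable_geometric_of_lt_one (by positivity) (hx1 hp)).mul_left _
  have htsum : ∀ {p : ℕ}, p.Prime → ∑' n : ℕ, f (p ^ n) ≤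
      Real.exp (1 / (p * (p - 1))) * (1 - (p : ℝ)⁻¹)⁻¹ := by
    intro p hp
    rw [(hsm hp).tsum_eq_zero_add]
    simp_rw [hpow hp]
    rw [tsum_mul_left, tsum_geometric_of_lt_one (by positivity) (hx1 hp), pow_zero, hf1]
    have hp1 : (1 : ℝ) < p := by exact_mod_cast hp.one_lt
    have hp2 : (0 : ℝ) < p - 1 := by linarith
    have he := Real.add_one_le_exp (1 / ((p : ℝ) * (p - 1)))
    have ha := pf_pos hp
    calc _ = (1 / ((p : ℝ) * (p - 1)) + 1) * (1 - (p : ℝ)⁻¹)⁻¹ := by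
          have : (1 - (p : ℝ)⁻¹) = (p - 1) / p := by field_simp
          rw [this]
          field_simp
          ring
      _ ≤ _ := by gcongr
  have hE := EulerProduct.summable_and_hasSum_factoredNumbers_prod_filter_prime_tsum hf1 hmul
    (fun {p} hp => (hsm hp).norm) s
  rw [hsp] at hE
  have hmem : ∀ c ∈ (Ioc 0 M).filter (fun c => c.Coprime N), c ∈ Nat.factoredNumbers s := by
    intro c hc
    simp only [mem_filter, mem_Ioc] at hc
    rw [Nat.mem_factoredNumbers_iff_forall_le]
    refine ⟨by omega, fun p hpc hp hd => ?_⟩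
    simp only [hs, mem_filter, Nat.mem_primesLE]
    exact ⟨⟨by omega, hp⟩, fun hN => Nat.not_coprime_of_dvd_of_dvd hp.one_lt hd hN hc.2⟩
  have h1 : GG N M ≤ ∏ p ∈ s, ∑' n : ℕ, f (p ^ n) := by
    rw [← hE.2.tsum_eq]
    unfold GG
    rw [← Finset.sum_subtype_of_mem (p := fun c => c ∈ Nat.factoredNumbers s) f hmem]
    exact hE.2.summable.sum_le_tsum _ (fun i _ => hf0 _)
  refine h1.trans ?_
  calc _ ≤ ∏ p ∈ s, (Real.exp (1 / (p * (p - 1))) * (1 - (p : ℝ)⁻¹)⁻¹) := by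
        apply Finset.prod_le_prod
        · intro p _
          exact tsum_nonneg fun _ => hf0 _
        · intro p hp
          exact htsum (Nat.prime_of_mem_primesLE (Finset.mem_filter.1 hp).1)
    _ ≤ _ := by
        rw [Finset.prod_mul_distrib, ← Real.exp_sum]
        apply mul_le_mul_of_nonneg_right
        · apply Real.exp_le_exp.2
          refine le_trans (Finset.sum_le_sum_of_subset_of_nonneg (Finset.filter_subset _ _) ?_) (telesum M)
          intro p hp _
          have : (1 : ℝ) < p := by exact_mod_cast (Nat.prime_of_mem_primesLE hp).one_lt
          have hp2 : (0 : ℝ) < p - 1 := by linarith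
          positivity
        · apply Finset.prod_nonneg
          intro p hp
          exact (inv_pos.2 (pf_pos (Nat.prime_of_mem_primesLE (Finset.mem_filter.1 hp).1))).le

lemma card_pf {N H : ℕ} (hN : N ≠ 0) (h : N < 2 ^ H) : N.primeFactors.card ≤ H := by
  have h1 : 2 ^ N.primeFactors.card ≤ N := by
    calc _ ≤ ∏ p ∈ N.primeFactors, p :=
          Finset.pow_card_le_prod _ _ _ (fun p hp => (Nat.prime_of_mem_primeFactors hp).two_le)
      _ ≤ N := Nat.le_of_dvd (Nat.pos_of_ne_zero hN) (Nat.prod_primeFactors_dvd N)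
  exact ((Nat.pow_lt_pow_iff_right (by norm_num)).1 (h1.trans_lt h)).le

lemma GG_rho {C1 : ℝ} (hC1 : ∀ M : ℕ, 4 ≤ M → PP M ≤ C1 * Real.log M)
    {N M z H : ℕ} (hN : N ≠ 0) (hNH : N < 2 ^ (8 * H)) (hM : M ≤ z) (hH : H ≤ z) (hz : 4 ≤ z) :
    GG N M / rho N ≤ Real.exp 9 * C1 * Real.log z := by
  have h1 := GG_le N M
  have h2 : (∏ p ∈ (Nat.primesLE M).filter (fun p => ¬ p ∣ N), (1 - (p : ℝ)⁻¹)⁻¹) * (rho N)⁻¹ ≤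
      PP z * ∏ p ∈ N.primeFactors.filter (fun p => z < p), (1 - (p : ℝ)⁻¹)⁻¹ := by
    unfold rho PP
    rw [← Finset.prod_inv_distrib, ← Finset.prod_union, ← Finset.prod_union]
    · apply Finset.prod_le_prod_of_subset_of_one_le
      · intro p hp
        simp only [mem_union, mem_filter, Nat.mem_primesLE, Nat.mem_primeFactors] at hp ⊢
        rcases hp with hp | hp
        · left; exact ⟨hp.1.1.trans hM, hp.1.2⟩
        · rcases le_or_gt p z with h | h
          · left; exact ⟨h, hp.1⟩
          · right; exact ⟨hp, h⟩
      · intro p hp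
        simp only [mem_union, mem_filter, Nat.mem_primesLE, Nat.mem_primeFactors] at hp
        have hp' : p.Prime := by tauto
        exact (inv_pos.2 (pf_pos hp')).le
      · intro p hp _
        simp only [mem_union, mem_filter, Nat.mem_primesLE, Nat.mem_primeFactors] at hp
        have hp' : p.Prime := by tauto
        exact one_le_pfinv hp'
    · rw [Finset.disjoint_left]
      intro p hp hp2
      simp only [mem_filter, Nat.mem_primesLE, Nat.mem_primeFactors] at hp hp2
      omega
    · rw [Finset.disjoint_left]
      intro p hp hp2
      simp only [mem_filter, Nat.mem_primesLE, Nat.mem_primeFactors] at hp hp2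
      tauto
  have hz0 : (0 : ℝ) < z := by exact_mod_cast (by omega : 0 < z)
  have h3 : ∏ p ∈ N.primeFactors.filter (fun p => z < p), (1 - (p : ℝ)⁻¹)⁻¹ ≤ Real.exp 8 := by
    calc _ ≤ ∏ p ∈ N.primeFactors.filter (fun p => z < p), Real.exp (1 / z) := by
          apply Finset.prod_le_prod
          · intro p hp
            simp only [mem_filter, Nat.mem_primeFactors] at hp
            exact (inv_pos.2 (pf_pos hp.1.1)).le
          · intro p hp
            simp only [mem_filter, Nat.mem_primeFactors] at hp
            have hp1 : (z : ℝ) + 1 ≤ p := by exact_mod_cast hp.2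
            have hp0 : (0 : ℝ) < p - 1 := by linarith
            have he := Real.add_one_le_exp (1 / (z : ℝ))
            have hpp : (0 : ℝ) < p := by linarith
            have h4 : (1 - (p : ℝ)⁻¹)⁻¹ = 1 / (p - 1) + 1 := by
              have : (1 - (p : ℝ)⁻¹) = (p - 1) / p := by field_simp
              rw [this]
              field_simp
              ring
            rw [h4]
            have : 1 / ((p : ℝ) - 1) ≤ 1 / z := one_div_le_one_div_of_le hz0 (by linarith)
            linarith
      _ = Real.exp ((N.primeFactors.filter (fun p => z < p)).card * (1 / z)) := by
          rw [Finset.prod_const, ← Real.exp_nat_mul]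
      _ ≤ Real.exp 8 := by
          apply Real.exp_le_exp.2
          have h5 : (N.primeFactors.filter (fun p => z < p)).card ≤ 8 * z :=
            (Finset.card_filter_le _ _).trans ((card_pf hN hNH).trans (by omega))
          have h6 : ((N.primeFactors.filter (fun p => z < p)).card : ℝ) ≤ 8 * z := by exact_mod_cast h5
          rw [mul_one_div, div_le_iff₀ hz0]
          exact h6
  have h4 := hC1 z hz
  have hr := rho_pos N
  calc GG N M / rho N ≤ (Real.exp 1 * ∏ p ∈ (Nat.primesLE M).filter (fun p => ¬ p ∣ N), (1 - (p : ℝ)⁻¹)⁻¹) * (rho N)⁻¹ := by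
        rw [div_eq_mul_inv]; gcongr
    _ ≤ Real.exp 1 * (PP z * ∏ p ∈ N.primeFactors.filter (fun p => z < p), (1 - (p : ℝ)⁻¹)⁻¹) := by
        rw [mul_assoc]; gcongr
    _ ≤ Real.exp 1 * (PP z * Real.exp 8) := by
        have := PP_pos z
        gcongr
    _ ≤ Real.exp 1 * (C1 * Real.log z * Real.exp 8) := by gcongr
    _ = _ := by
        rw [show (9 : ℝ) = 1 + 8 by norm_num, Real.exp_add]; ring

lemma rho_mul_pp {m d : ℕ} (hm : m ≠ 0) (hd : IsPrimePow d) : (rho (m * d))⁻¹ ≤ 2 * (rho m)⁻¹ := by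
  obtain ⟨p, k, hp, hk, rfl⟩ := hd
  have hp := hp.nat_prime
  have h1 : rho m * (1 / 2) ≤ rho (m * p ^ k) := by
    unfold rho
    rw [Nat.primeFactors_mul hm (pow_ne_zero _ hp.ne_zero), Nat.primeFactors_prime_pow hk.ne' hp]
    by_cases h : p ∈ m.primeFactors
    · rw [Finset.union_eq_left.2 (by simpa using h)]
      have := rho_pos m
      unfold rho at this
      linarith
    · rw [Finset.prod_union (by simpa using h), Finset.prod_singleton]
      have := rho_pos m
      unfold rho at this
      have := pf_half hp
      gcongr
  have h2 := rho_pos m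
  calc (rho (m * p ^ k))⁻¹ ≤ (rho m * (1 / 2))⁻¹ := inv_anti₀ (by positivity) h1
    _ = _ := by rw [mul_inv]; ring

lemma hall (N M : ℕ) : FF N M * Real.log M ≤ (2 * (Real.log 4 + 4) + 1) * (M * GG N M) := by
  classical
  let g : ArithmeticFunction ℝ := ⟨fun c => if c = 0 then 0 else if c.Coprime N then (rho c)⁻¹ else 0, by simp⟩
  have hg : ∀ c, c ≠ 0 → g c = if c.Coprime N then (rho c)⁻¹ else 0 := by
    intro c hc
    show (if c = 0 then 0 else if c.Coprime N then (rho c)⁻¹ else 0) = _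
    rw [if_neg hc]
  have hg0 : ∀ c, 0 ≤ g c := by
    intro c
    show 0 ≤ (if c = 0 then 0 else if c.Coprime N then (rho c)⁻¹ else 0)
    have := rho_pos c
    split_ifs <;> positivity
  have hF : FF N M = ∑ c ∈ Ioc 0 M, g c := by
    unfold FF
    rw [Finset.sum_filter]
    apply Finset.sum_congr rfl
    intro c hc
    rw [hg c (by simp at hc; omega)]
  have hG : M * GG N M = ∑ c ∈ Ioc 0 M, g c * (M / c) := by
    unfold GG
    rw [Finset.sum_filter, Finset.mul_sum]
    apply Finset.sum_congr rfl
    intro c hc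
    rw [hg c (by simp at hc; omega)]
    split_ifs
    · rw [mul_inv]; ring
    · simp
  have hsub : ∀ c ∈ Ioc 0 M, g c * Real.log c ≤ 2 * (g * ArithmeticFunction.vonMangoldt) c := by
    intro c hc
    simp only [mem_Ioc] at hc
    rw [← ArithmeticFunction.vonMangoldt_sum, ArithmeticFunction.mul_apply, ← Nat.sum_divisorsAntidiagonal' (f := fun _ y => ArithmeticFunction.vonMangoldt y),
      Finset.mul_sum, Finset.mul_sum]
    apply Finset.sum_le_sum
    rintro ⟨m, d⟩ hx
    simp only [Nat.mem_divisorsAntidiagonal] at hx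
    obtain ⟨rfl, hne⟩ := hx
    have hm : m ≠ 0 := fun h => by simp [h] at hne
    have hv : 0 ≤ ArithmeticFunction.vonMangoldt d := ArithmeticFunction.vonMangoldt_nonneg
    by_cases hd : IsPrimePow d
    · have : g (m * d) ≤ 2 * g m := by
        rw [hg _ hne, hg _ hm]
        have := rho_pos m
        by_cases h1 : (m * d).Coprime N
        · rw [if_pos h1, if_pos (Nat.Coprime.coprime_mul_right h1)]
          exact rho_mul_pp hm hd
        · rw [if_neg h1]
          split_ifs <;> positivity
      calc _ ≤ 2 * g m * ArithmeticFunction.vonMangoldt d := by gcongr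
        _ = _ := by ring
    · rw [ArithmeticFunction.vonMangoldt_eq_zero_iff.2 hd]; simp
  have hlog : ∑ c ∈ Ioc 0 M, g c * Real.log c ≤ 2 * (Real.log 4 + 4) * (M * GG N M) := by
    calc _ ≤ ∑ c ∈ Ioc 0 M, 2 * (g * ArithmeticFunction.vonMangoldt) c := Finset.sum_le_sum hsub
      _ = 2 * ∑ n ∈ Ioc 0 M, g n * ∑ m ∈ Ioc 0 (M / n), ArithmeticFunction.vonMangoldt m := by
          rw [← Finset.mul_sum, ArithmeticFunction.sum_Ioc_mul_eq_sum_sum]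
      _ ≤ 2 * ∑ n ∈ Ioc 0 M, g n * ((Real.log 4 + 4) * (M / n)) := by
          apply mul_le_mul_of_nonneg_left _ (by norm_num)
          apply Finset.sum_le_sum
          intro n hn
          apply mul_le_mul_of_nonneg_left _ (hg0 n)
          have h1 := Chebyshev.psi_le_const_mul_self (x := ((M : ℝ) / n)) (by positivity)
          unfold Chebyshev.psi at h1
          rwa [Nat.floor_div_natCast, Nat.floor_natCast] at h1
      _ = _ := by
          rw [hG, Finset.mul_sum, Finset.mul_sum]
          apply Finset.sum_congr rfl
          intro n _
          ring
  have hlog2 : FF N M * Real.log M ≤ ∑ c ∈ Ioc 0 M, (g c * Real.log c + g c * (M / c)) := by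
    rw [hF, Finset.sum_mul]
    apply Finset.sum_le_sum
    intro c hc
    simp only [mem_Ioc] at hc
    rw [← mul_add]
    apply mul_le_mul_of_nonneg_left _ (hg0 c)
    have hc0 : (0 : ℝ) < c := by exact_mod_cast hc.1
    have hM0 : (0 : ℝ) < M := by exact_mod_cast (by omega : 0 < M)
    have h1 := Real.log_le_sub_one_of_pos (div_pos hM0 hc0)
    rw [Real.log_div hM0.ne' hc0.ne'] at h1
    linarith
  rw [Finset.sum_add_distrib, ← hG] at hlog2
  linarith


noncomputable def RR (N : ℕ) (y : ℝ) : ℝ := FF N ⌊y⌋₊ / (rho N * y)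

lemma geo_exp (X : ℝ) (hX : 0 < X) (K : ℕ) :
    (∑ k ∈ Icc 1 K, if Real.exp (k : ℝ) ≤ X then Real.exp (k : ℝ) else 0) ≤ 2 * X ∧
    (∑ k ∈ Icc 1 K, if Real.exp (k : ℝ) ≤ X then Real.exp (k : ℝ) else 0) ≤ 2 * Real.exp K := by
  induction K with
  | zero => simp [hX.le]
  | succ k ih =>
    rw [Finset.sum_Icc_succ_top (by omega)]
    have he : 2 * Real.exp (k : ℝ) ≤ Real.exp ((k + 1 : ℕ) : ℝ) := by
      push_cast
      rw [Real.exp_add]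
      have := Real.add_one_le_exp 1
      have h0 := Real.exp_pos (k : ℝ)
      nlinarith
    have h0 := Real.exp_pos (k : ℝ)
    split_ifs with h
    · constructor <;> linarith
    · constructor <;> linarith

lemma avg {C1 : ℝ} (hC0 : 0 < C1) (hC1 : ∀ M : ℕ, 4 ≤ M → PP M ≤ C1 * Real.log M) (ε : ℝ) (hε : 0 < ε) :
    ∃ C : ℝ, 0 < C ∧ ∀ h : ℕ, 1 ≤ h → 1 ≤ ⌊ε * h * Real.log 4⌋₊ → ∀ N : ℕ, N ≠ 0 → N < 2 ^ (8 * 4 ^ h) →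
      ∀ Y : ℝ, 0 < Y → ∑ k ∈ Icc 1 ⌊ε * h * Real.log 4⌋₊, RR N (Y / Real.exp k) ≤ C * ⌊ε * h * Real.log 4⌋₊ := by
  set A := Real.exp 9 * C1 with hA
  have hA0 : 0 < A := by positivity
  set C3 := 2 * (Real.log 4 + 4) + 1 with hC3
  have hl4 : 0 < Real.log 4 := Real.log_pos (by norm_num)
  have hC30 : 0 < C3 := by positivity
  refine ⟨2 * A * (2 + 2 / ε) + C3 * A * (1 + 4 / ε), by positivity, ?_⟩
  intro h hh hK N hN hNH Y hY
  set K := ⌊ε * h * Real.log 4⌋₊ with hKdef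
  have hK1 : (1 : ℝ) ≤ K := by exact_mod_cast hK
  set T := (h : ℝ) * Real.log 4 with hT
  have hTK : T ≤ 2 / ε * K := by
    have h1 : ε * h * Real.log 4 < K + 1 := Nat.lt_floor_add_one _
    have h2 : ε * T < K + 1 := by rw [hT]; linarith
    rw [div_mul_eq_mul_div, le_div_iff₀ hε]
    linarith
  have hT0 : 0 < T := by
    have : (0 : ℝ) < h := by exact_mod_cast hh
    positivity
  have hr := rho_pos N
  have h4h : 4 ≤ 4 ^ h := by
    calc 4 = 4 ^ 1 := by norm_num
      _ ≤ 4 ^ h := Nat.pow_le_pow_right (by norm_num) hh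
  have hlogz : ∀ M : ℕ, ∀ B : ℝ, 0 ≤ B → (1 ≤ M → Real.log M ≤ B) → Real.log ((max M (4 ^ h) : ℕ) : ℝ) ≤ B + T := by
    intro M B hB hMB
    rcases le_total M (4 ^ h) with h1 | h1
    · rw [max_eq_right h1]
      push_cast
      rw [Real.log_pow]
      linarith
    · rw [max_eq_left h1]
      have := hMB (by omega)
      linarith
  have hGG : ∀ M : ℕ, GG N M / rho N ≤ A * Real.log ((max M (4 ^ h) : ℕ) : ℝ) := fun M =>
    GG_rho hC1 hN hNH (le_max_left _ _) (le_max_right _ _) (h4h.trans (le_max_right _ _))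
  rcases le_or_gt Y (Real.exp (2 * K)) with hY2 | hY2
  · have h1 : ∑ k ∈ Icc 1 K, RR N (Y / Real.exp k) ≤ 2 * (GG N ⌊Y⌋₊ / rho N) := by
      have e1 : ∀ k ∈ Icc 1 K, RR N (Y / Real.exp k) =
          ∑ c ∈ (Ioc 0 ⌊Y⌋₊).filter (fun c => c.Coprime N),
            (rho c)⁻¹ / (rho N * Y) * (if Real.exp (k : ℝ) ≤ Y / c then Real.exp (k : ℝ) else 0) := by
        intro k hk
        unfold RR FF
        have e2 : (Ioc 0 ⌊Y / Real.exp k⌋₊).filter (fun c => c.Coprime N) =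
            ((Ioc 0 ⌊Y⌋₊).filter (fun c => c.Coprime N)).filter (fun c : ℕ => Real.exp (k : ℝ) ≤ Y / (c : ℝ)) := by
          ext c
          simp only [mem_filter, mem_Ioc]
          have hek := Real.exp_pos (k : ℝ)
          have hek1 : 1 ≤ Real.exp (k : ℝ) := Real.one_le_exp (by positivity)
          rw [Nat.le_floor_iff (by positivity), Nat.le_floor_iff hY.le]
          constructor
          · rintro ⟨⟨a, b⟩, c2⟩
            have hc : (0 : ℝ) < c := by exact_mod_cast a
            rw [le_div_iff₀ hek] at b
            refine ⟨⟨⟨a, ?_⟩, c2⟩, ?_⟩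
            · nlinarith
            · rw [le_div_iff₀ hc]; linarith
          · rintro ⟨⟨⟨a, b⟩, c2⟩, d⟩
            have hc : (0 : ℝ) < c := by exact_mod_cast a
            rw [le_div_iff₀ hc] at d
            refine ⟨⟨a, ?_⟩, c2⟩
            rw [le_div_iff₀ hek]; linarith
        rw [e2, Finset.sum_filter _ (f := fun c => (rho c)⁻¹), Finset.sum_div]
        apply Finset.sum_congr rfl
        intro c _
        split_ifs
        · field_simp
        · simp
      rw [Finset.sum_congr rfl e1, Finset.sum_comm]
      unfold GG
      rw [Finset.sum_div, Finset.mul_sum]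
      apply Finset.sum_le_sum
      intro c hc
      simp only [mem_filter, mem_Ioc] at hc
      have hc0 : (0 : ℝ) < c := by exact_mod_cast hc.1.1
      have hrc := rho_pos c
      rw [← Finset.mul_sum]
      calc _ ≤ (rho c)⁻¹ / (rho N * Y) * (2 * (Y / c)) := by
            apply mul_le_mul_of_nonneg_left (geo_exp _ (by positivity) K).1 (by positivity)
        _ = _ := by field_simp
    have h2 := hlogz ⌊Y⌋₊ (2 * K) (by positivity) (by
      intro hM
      rw [Real.log_le_iff_le_exp (by exact_mod_cast hM)]
      exact (Nat.floor_le hY.le).trans hY2)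
    have h3 := hGG ⌊Y⌋₊
    have h5 : A * Real.log ((max ⌊Y⌋₊ (4 ^ h) : ℕ) : ℝ) ≤ A * (2 * K + 2 / ε * K) := by
      apply mul_le_mul_of_nonneg_left _ hA0.le
      linarith
    calc _ ≤ 2 * (A * (2 * K + 2 / ε * K)) := by linarith
      _ = 2 * A * (2 + 2 / ε) * K := by ring
      _ ≤ _ := by
        apply mul_le_mul_of_nonneg_right _ (by positivity)
        have : 0 < C3 * A * (1 + 4 / ε) := by positivity
        linarith
  · have h1 : ∀ k ∈ Icc 1 K, RR N (Y / Real.exp k) ≤ C3 * A * (1 + 4 / ε) := by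
      intro k hk
      simp only [mem_Icc] at hk
      have hkK : (k : ℝ) ≤ K := by exact_mod_cast hk.2
      set y := Y / Real.exp k with hy
      have hyK : Real.exp K ≤ y := by
        rw [hy, le_div_iff₀ (Real.exp_pos _), ← Real.exp_add]
        refine le_trans (Real.exp_le_exp.2 ?_) hY2.le
        linarith
      have hy2 : 2 ≤ y := by
        have h1 := Real.add_one_le_exp (K : ℝ)
        linarith
      set M := ⌊y⌋₊ with hM
      have hM2 : 2 ≤ M := by
        rw [hM, Nat.le_floor_iff (by linarith)]
        exact_mod_cast hy2
      have hM2' : (2 : ℝ) ≤ M := by exact_mod_cast hM2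
      have hMy : (M : ℝ) ≤ y := Nat.floor_le (by linarith)
      have hyM : y < M + 1 := Nat.lt_floor_add_one y
      have hlM : 0 < Real.log M := Real.log_pos (by linarith)
      have hKM : K ≤ 2 * Real.log M := by
        have : Real.log ((M : ℝ) ^ 2) = 2 * Real.log M := by
          rw [Real.log_pow]; norm_num
        rw [← this, Real.le_log_iff_exp_le (by positivity)]
        nlinarith
      have h2 := hlogz M (Real.log M) hlM.le (fun _ => le_refl _)
      have h3 := hGG M
      have h5 : A * Real.log ((max M (4 ^ h) : ℕ) : ℝ) ≤ A * ((1 + 4 / ε) * Real.log M) := by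
        apply mul_le_mul_of_nonneg_left _ hA0.le
        have : 2 / ε * K ≤ 2 / ε * (2 * Real.log M) := by gcongr
        have e : 2 / ε * (2 * Real.log M) = 4 / ε * Real.log M := by ring
        linarith
      have h6 := hall N M
      have hF := FF_nonneg N M
      show FF N M / (rho N * y) ≤ _
      calc FF N M / (rho N * y) ≤ FF N M / (rho N * M) := by gcongr
        _ = FF N M * Real.log M / (rho N * M * Real.log M) := by field_simp
        _ ≤ C3 * (M * GG N M) / (rho N * M * Real.log M) := by gcongr
        _ = C3 * (GG N M / rho N) / Real.log M := by field_simp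
        _ ≤ C3 * (A * ((1 + 4 / ε) * Real.log M)) / Real.log M := by
            gcongr
            exact h3.trans h5
        _ = _ := by field_simp
    calc _ ≤ ∑ k ∈ Icc 1 K, C3 * A * (1 + 4 / ε) := Finset.sum_le_sum h1
      _ = C3 * A * (1 + 4 / ε) * K := by simp; ring
      _ ≤ _ := by
        apply mul_le_mul_of_nonneg_right _ (by positivity)
        have : 0 < 2 * A * (2 + 2 / ε) := by positivity
        linarith


lemma sieve_card (g : ℕ) (hg : g ≠ 0) (B : ℕ → Finset ℕ) :
    ((range g).filter (fun t => ∀ p ∈ g.primeFactors, t % p ∉ B p)).card ≤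
      g / (∏ p ∈ g.primeFactors, p) * ∏ p ∈ g.primeFactors, (range p \ B p).card := by
  set r := ∏ p ∈ g.primeFactors, p with hr
  have hrg : r ∣ g := Nat.prod_primeFactors_dvd g
  have hr0 : 0 < r := Nat.pos_of_dvd_of_pos hrg (Nat.pos_of_ne_zero hg)
  rw [← Finset.card_pi, ← Finset.card_range (g / r), ← Finset.card_product]
  apply Finset.card_le_card_of_injOn (fun t => (t / r, fun p _ => t % p))
  · intro t ht
    simp only [coe_filter, mem_range, Set.mem_setOf_eq] at ht
    simp only [coe_product, Set.mem_prod, SetLike.mem_coe, mem_range, Finset.mem_pi, mem_sdiff]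
    refine ⟨?_, ?_⟩
    · exact Nat.div_lt_div_of_lt_of_dvd hrg ht.1
    · intro p hp
      exact Finset.mem_sdiff.2 ⟨Finset.mem_range.2 (Nat.mod_lt _ (Nat.prime_of_mem_primeFactors hp).pos), ht.2 p hp⟩
  · intro t _ t' _ h
    simp only [Prod.mk.injEq] at h
    have hmod : t ≡ t' [MOD r] := by
      rw [Nat.modEq_iff_dvd, hr]
      push_cast
      apply Finset.prod_dvd_of_coprime
      · intro p hp q hq hpq
        simp only [SetLike.mem_coe] at hp hq
        simp only [Function.onFun]
        exact Nat.isCoprime_iff_coprime.2 ((Nat.coprime_primes (Nat.prime_of_mem_primeFactors hp)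
          (Nat.prime_of_mem_primeFactors hq)).2 hpq)
      · intro p hp
        have := congrFun (congrFun h.2 p) hp
        exact Nat.modEq_iff_dvd.1 this
    rw [← Nat.div_add_mod t r, ← Nat.div_add_mod t' r, h.1, hmod]

lemma root_exists {p : ℕ} (hp : p.Prime) (a u : ℤ) (hu : ¬ (p : ℤ) ∣ u) :
    ∃ t ∈ range p, (p : ℤ) ∣ a + u * t := by
  have hc : IsCoprime u (p : ℤ) := by
    rw [isCoprime_comm]
    exact (Prime.coprime_iff_not_dvd (Nat.prime_iff_prime_int.1 hp)).2 hu
  obtain ⟨x, y, hxy⟩ := hc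
  have hp0 : (0 : ℤ) < p := by exact_mod_cast hp.pos
  have h1 := Int.emod_nonneg (-a * x) hp0.ne'
  have h2 := Int.emod_lt_of_pos (-a * x) hp0
  refine ⟨((-a * x) % p).toNat, ?_, ?_⟩
  · simp only [mem_range]; omega
  · rw [Int.toNat_of_nonneg h1]
    have h3 := Int.emod_add_mul_ediv (-a * x) p
    have : (-a * x) % p = -a * x - p * ((-a * x) / p) := by linarith
    rw [this]
    refine ⟨a * y - u * ((-a * x) / p), ?_⟩
    linear_combination (-a) * hxy

/-- solution set -/
def SS (m n m' n' : ℕ) (c : ℤ) : Finset (ℕ × ℕ) :=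
  (((Icc 1 m).filter (fun a => Nat.Coprime a m)) ×ˢ ((Icc 1 n).filter (fun a => Nat.Coprime a n))).filter
    (fun x => ((m * n' : ℕ) : ℤ) ∣ (x.1 : ℤ) * n' - (x.2 : ℤ) * m' - c)

lemma SS_coprime {g m' n' : ℕ} {c : ℤ} (hcop : Nat.Coprime m' n') {x : ℕ × ℕ}
    (hx : x ∈ SS (g * m') (g * n') m' n' c) : c.natAbs.Coprime (m' * n') := by
  simp only [SS, mem_filter, mem_product, mem_Icc] at hx
  obtain ⟨⟨⟨_, ha⟩, ⟨_, hb⟩⟩, hd⟩ := hx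
  rw [Nat.coprime_iff_gcd_eq_one]
  by_contra hne
  obtain ⟨p, hp, hpd⟩ := Nat.exists_prime_and_dvd hne
  have hpc : (p : ℤ) ∣ c := Int.natCast_dvd.2 (hpd.trans (Nat.gcd_dvd_left _ _))
  have hpN : p ∣ m' * n' := hpd.trans (Nat.gcd_dvd_right _ _)
  have hpL : (p : ℤ) ∣ ((g * m' * n' : ℕ) : ℤ) := by
    rw [mul_assoc]; exact_mod_cast hpN.mul_left g
  have h1 : (p : ℤ) ∣ (x.1 : ℤ) * n' - (x.2 : ℤ) * m' := by
    have := dvd_add (hpL.trans hd) hpc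
    simpa using this
  have hpp := Nat.prime_iff_prime_int.1 hp
  rcases (hp.dvd_mul).1 hpN with h | h
  · have h2 : (p : ℤ) ∣ (x.1 : ℤ) * n' := by
      have := dvd_add h1 ((Int.natCast_dvd_natCast.2 h).mul_left (x.2 : ℤ))
      simpa using this
    have h3 : p ∣ x.1 * n' := by exact_mod_cast h2
    rcases (hp.dvd_mul).1 h3 with h4 | h4
    · exact Nat.not_coprime_of_dvd_of_dvd hp.one_lt h4 (h.mul_left g) ha
    · exact Nat.not_coprime_of_dvd_of_dvd hp.one_lt h h4 hcop
  · have h2 : (p : ℤ) ∣ (x.2 : ℤ) * m' := by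
      have := dvd_sub ((Int.natCast_dvd_natCast.2 h).mul_left (x.1 : ℤ)) h1
      simpa using this
    have h3 : p ∣ x.2 * m' := by exact_mod_cast h2
    rcases (hp.dvd_mul).1 h3 with h4 | h4
    · exact Nat.not_coprime_of_dvd_of_dvd hp.one_lt h4 (h.mul_left g) hb
    · exact Nat.not_coprime_of_dvd_of_dvd hp.one_lt h4 h hcop

lemma SS_card1 {g m' n' : ℕ} {c : ℤ} (hg : g ≠ 0) (hm : m' ≠ 0) (hn : n' ≠ 0)
    {x : ℕ × ℕ} (hx : x ∈ SS (g * m') (g * n') m' n' c) (hcop : Nat.Coprime m' n') :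
    (SS (g * m') (g * n') m' n' c).card ≤ ((range g).filter (fun t => ∀ p ∈ g.primeFactors,
      t % p ∉ (range p).filter (fun t : ℕ => (p : ℤ) ∣ (x.1 : ℤ) + m' * (t : ℤ) ∨ (p : ℤ) ∣ (x.2 : ℤ) + n' * (t : ℤ)))).card := by
  have hg0 : (0 : ℤ) < g := by exact_mod_cast Nat.pos_of_ne_zero hg
  have hm0 : (m' : ℤ) ≠ 0 := by exact_mod_cast hm
  have hn0 : (n' : ℤ) ≠ 0 := by exact_mod_cast hn
  -- structure of solutions
  have key : ∀ y ∈ SS (g * m') (g * n') m' n' c, ∃ s u : ℤ, (y.1 : ℤ) = x.1 + m' * s ∧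
      (y.2 : ℤ) = x.2 + n' * s + g * n' * u := by
    intro y hy
    simp only [SS, mem_filter, mem_product, mem_Icc] at hx hy
    have hd := dvd_sub hy.2 hx.2
    obtain ⟨w, hw⟩ := hd
    push_cast at hw
    have h1 : (m' : ℤ) ∣ ((y.1 : ℤ) - x.1) * n' := ⟨g * n' * w + (y.2 - x.2), by linear_combination hw⟩
    have h2 : (m' : ℤ) ∣ (y.1 : ℤ) - x.1 :=
      (Nat.isCoprime_iff_coprime.2 hcop).dvd_of_dvd_mul_right h1
    obtain ⟨s, hs⟩ := h2
    refine ⟨s, -w, by linear_combination hs, ?_⟩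
    apply mul_left_cancel₀ hm0
    linear_combination (-1) * hw + n' * hs
  choose! s u hs hu using key
  apply Finset.card_le_card_of_injOn (fun y => (s y % g).toNat)
  · intro y hy
    have hy' : y ∈ SS (g * m') (g * n') m' n' c := hy
    have h1 := Int.emod_nonneg (s y) hg0.ne'
    have h2 := Int.emod_lt_of_pos (s y) hg0
    have e1 := hs y hy'
    have e2 := hu y hy'
    simp only [SS, mem_filter, mem_product, mem_Icc] at hy'
    simp only [coe_filter, mem_range, Set.mem_setOf_eq, mem_filter, not_and]
    refine ⟨by omega, ?_⟩
    intro p hp _ hor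
    have hpp := Nat.prime_of_mem_primeFactors hp
    have hpg := Nat.dvd_of_mem_primeFactors hp
    have hpg' : (p : ℤ) ∣ g := by exact_mod_cast hpg
    have hcong : (p : ℤ) ∣ s y - (((s y % g).toNat % p : ℕ) : ℤ) := by
      push_cast
      rw [Int.toNat_of_nonneg h1]
      have a1 : (p : ℤ) ∣ s y - s y % g := hpg'.trans (Int.dvd_self_sub_emod)
      have a2 : (p : ℤ) ∣ s y % g - (s y % g) % p := Int.dvd_self_sub_emod
      have := dvd_add a1 a2
      simpa using this
    generalize (((s y % g).toNat % p : ℕ) : ℤ) = t at hcong hor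
    rcases hor with h | h
    · have : (p : ℤ) ∣ y.1 := by
        rw [e1]
        have := dvd_add h (hcong.mul_left (m' : ℤ))
        have e : (x.1 : ℤ) + m' * t + m' * (s y - t) = x.1 + m' * s y := by ring
        rwa [e] at this
      exact Nat.not_coprime_of_dvd_of_dvd hpp.one_lt (by exact_mod_cast this) (hpg.mul_right m') hy'.1.1.2
    · have : (p : ℤ) ∣ y.2 := by
        rw [e2]
        have := dvd_add (dvd_add h (hcong.mul_left (n' : ℤ))) (hpg'.mul_right (n' * u y))
        have e : (x.2 : ℤ) + n' * t + n' * (s y - t) + g * (n' * u y) = x.2 + n' * s y + g * n' * u y := by ring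
        rwa [e] at this
      exact Nat.not_coprime_of_dvd_of_dvd hpp.one_lt (by exact_mod_cast this) (hpg.mul_right n') hy'.1.2.2
  · intro y hy z hz h
    have hy' : y ∈ SS (g * m') (g * n') m' n' c := hy
    have hz' : z ∈ SS (g * m') (g * n') m' n' c := hz
    have h1 := Int.emod_nonneg (s y) hg0.ne'
    have h2 := Int.emod_nonneg (s z) hg0.ne'
    have h3 : s y % g = s z % g := by
      simp only at h
      omega
    have h4 : (g : ℤ) ∣ s y - s z := Int.ModEq.dvd (Int.ModEq.symm h3)
    obtain ⟨w, hw⟩ := h4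
    have e1 := hs y hy'
    have e2 := hu y hy'
    have e3 := hs z hz'
    have e4 := hu z hz'
    simp only [SS, mem_filter, mem_product, mem_Icc] at hy' hz'
    have d1 : ((g * m' : ℕ) : ℤ) ∣ (y.1 : ℤ) - z.1 := ⟨w, by push_cast; linear_combination e1 - e3 + m' * hw⟩
    have d2 : ((g * n' : ℕ) : ℤ) ∣ (y.2 : ℤ) - z.2 :=
      ⟨w + u y - u z, by push_cast; linear_combination e2 - e4 + n' * hw⟩
    have f1 := Int.eq_zero_of_abs_lt_dvd d1 (by rw [abs_lt]; constructor <;> omega)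
    have f2 := Int.eq_zero_of_abs_lt_dvd d2 (by rw [abs_lt]; constructor <;> omega)
    ext <;> omega

lemma B_card {p : ℕ} (hp : p.Prime) {m' n' : ℕ} {a b c : ℤ} (hcop : Nat.Coprime m' n')
    (hc : (p : ℤ) ∣ a * n' - b * m' - c) :
    ((range p \ (range p).filter (fun t : ℕ => (p : ℤ) ∣ a + m' * (t : ℤ) ∨ (p : ℤ) ∣ b + n' * (t : ℤ))).card : ℝ) ≤
      p * ((1 - (p : ℝ)⁻¹) * (if p ∣ c.natAbs * (m' * n') then 1 else (1 - (p : ℝ)⁻¹))) := by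
  set B := (range p).filter (fun t : ℕ => (p : ℤ) ∣ a + m' * (t : ℤ) ∨ (p : ℤ) ∣ b + n' * (t : ℤ)) with hB
  have hsub : B ⊆ range p := Finset.filter_subset _ _
  rw [Finset.card_sdiff_of_subset hsub, Nat.cast_sub (Finset.card_le_card hsub), card_range]
  have hp0 : (0 : ℝ) < p := by exact_mod_cast hp.pos
  split_ifs with h
  · have : 1 ≤ B.card := by
      rw [Nat.one_le_iff_ne_zero, Finset.card_ne_zero]
      by_cases hm : p ∣ m'
      · have hn : ¬ p ∣ n' := fun hn => Nat.not_coprime_of_dvd_of_dvd hp.one_lt hm hn hcop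
        obtain ⟨t, ht, htd⟩ := root_exists hp b n' (by exact_mod_cast hn)
        exact ⟨t, by rw [hB, mem_filter]; exact ⟨ht, Or.inr htd⟩⟩
      · obtain ⟨t, ht, htd⟩ := root_exists hp a m' (by exact_mod_cast hm)
        exact ⟨t, by rw [hB, mem_filter]; exact ⟨ht, Or.inl htd⟩⟩
    have h' : (1 : ℝ) ≤ B.card := by exact_mod_cast this
    have : (p : ℝ) * ((1 - (p : ℝ)⁻¹) * 1) = p - 1 := by field_simp
    rw [this]
    linarith
  · have hm : ¬ p ∣ m' := fun h1 => h ((h1.mul_right n').mul_left _)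
    have hn : ¬ p ∣ n' := fun h1 => h ((h1.mul_left m').mul_left _)
    have hcc : ¬ (p : ℤ) ∣ c := fun h1 => h ((Int.natCast_dvd.1 h1).mul_right _)
    obtain ⟨t, ht, htd⟩ := root_exists hp a m' (by exact_mod_cast hm)
    obtain ⟨t', ht', htd'⟩ := root_exists hp b n' (by exact_mod_cast hn)
    have hne : t ≠ t' := by
      rintro rfl
      apply hcc
      have := dvd_sub (dvd_sub (htd.mul_right (n' : ℤ)) (htd'.mul_right (m' : ℤ))) hc
      have e : (a + m' * (t : ℤ)) * n' - (b + n' * (t : ℤ)) * m' - (a * n' - b * m' - c) = c := by ring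
      rwa [e] at this
    have : 2 ≤ B.card := by
      rw [← Finset.card_pair hne]
      apply Finset.card_le_card
      intro w hw
      simp only [mem_insert, mem_singleton] at hw
      rw [hB, mem_filter]
      rcases hw with rfl | rfl
      · exact ⟨ht, Or.inl htd⟩
      · exact ⟨ht', Or.inr htd'⟩
    have h' : (2 : ℝ) ≤ B.card := by exact_mod_cast this
    have : (p : ℝ) * ((1 - (p : ℝ)⁻¹) * (1 - (p : ℝ)⁻¹)) = p - 2 + (p : ℝ)⁻¹ := by field_simp; ring
    rw [this]
    have : 0 < (p : ℝ)⁻¹ := by positivity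
    linarith

lemma SS_card {g m' n' : ℕ} {c : ℤ} (hg : g ≠ 0) (hm : m' ≠ 0) (hn : n' ≠ 0) (hc0 : c ≠ 0)
    (hcop : Nat.Coprime m' n') :
    ((SS (g * m') (g * n') m' n' c).card : ℝ) ≤
      if c.natAbs.Coprime (m' * n') then
        g * rho (g * m') * rho (g * n') / rho (m' * n') * (rho c.natAbs)⁻¹ else 0 := by
  rcases Finset.eq_empty_or_nonempty (SS (g * m') (g * n') m' n' c) with he | ⟨x, hx⟩
  · rw [he]
    have h1 := rho_pos (g * m')
    have h2 := rho_pos (g * n')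
    have h3 := rho_pos (m' * n')
    have h4 := rho_pos c.natAbs
    split_ifs
    · simp only [card_empty, Nat.cast_zero]; positivity
    · simp
  have hcN := SS_coprime hcop hx
  rw [if_pos hcN]
  have h1 := (SS_card1 hg hm hn hx hcop).trans (sieve_card g hg _)
  have h2 : ((SS (g * m') (g * n') m' n' c).card : ℝ) ≤
      ((g / (∏ p ∈ g.primeFactors, p) : ℕ) : ℝ) * ∏ p ∈ g.primeFactors,
      ((range p \ (range p).filter (fun t : ℕ => (p : ℤ) ∣ (x.1 : ℤ) + m' * (t : ℤ) ∨ (p : ℤ) ∣ (x.2 : ℤ) + n' * (t : ℤ))).card : ℝ) := by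
    exact_mod_cast h1
  have hd : ((g * m' * n' : ℕ) : ℤ) ∣ (x.1 : ℤ) * n' - (x.2 : ℤ) * m' - c := by
    simp only [SS, mem_filter] at hx
    exact hx.2
  have h3 : ∏ p ∈ g.primeFactors,
      ((range p \ (range p).filter (fun t : ℕ => (p : ℤ) ∣ (x.1 : ℤ) + m' * (t : ℤ) ∨ (p : ℤ) ∣ (x.2 : ℤ) + n' * (t : ℤ))).card : ℝ) ≤
      ∏ p ∈ g.primeFactors, ((p : ℝ) * ((1 - (p : ℝ)⁻¹) * (if p ∣ c.natAbs * (m' * n') then 1 else (1 - (p : ℝ)⁻¹)))) := by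
    apply Finset.prod_le_prod
    · intro p _; positivity
    · intro p hp
      apply B_card (Nat.prime_of_mem_primeFactors hp) hcop
      refine dvd_trans ?_ hd
      have := Nat.dvd_of_mem_primeFactors hp
      exact_mod_cast (this.mul_right m').mul_right n'
  have h4 : ((g / (∏ p ∈ g.primeFactors, p) : ℕ) : ℝ) * ∏ p ∈ g.primeFactors, (p : ℝ) = g := by
    rw [← Nat.cast_prod, ← Nat.cast_mul, Nat.div_mul_cancel (Nat.prod_primeFactors_dvd g)]
  set Q := ∏ p ∈ g.primeFactors.filter (fun p => ¬ p ∣ c.natAbs * (m' * n')), (1 - (p : ℝ)⁻¹) with hQ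
  have h5 : ((SS (g * m') (g * n') m' n' c).card : ℝ) ≤ g * (rho g * Q) := by
    refine h2.trans ((mul_le_mul_of_nonneg_left h3 (by positivity)).trans (le_of_eq ?_))
    rw [Finset.prod_mul_distrib, Finset.prod_mul_distrib, ← mul_assoc, h4, hQ, Finset.prod_filter]
    congr 2
    apply Finset.prod_congr rfl
    intro p _
    by_cases h : p ∣ c.natAbs * (m' * n') <;> simp [h]
  have hc0' : c.natAbs ≠ 0 := by simpa using hc0
  have h6 : Q * (rho c.natAbs * rho (m' * n')) ≤ rho (g * m' * (g * n')) := by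
    rw [← rho_mul hcN, hQ]
    unfold rho
    rw [← Finset.prod_union]
    · apply Finset.prod_le_prod_of_subset_of_le_one
      · intro p hp
        simp only [mem_union, mem_filter, Nat.mem_primeFactors] at hp ⊢
        obtain ⟨hp1, hp2, -⟩ := hp
        by_cases hcp : p ∣ c.natAbs * (m' * n')
        · right
          exact ⟨hp1, hcp, by positivity⟩
        · left
          refine ⟨⟨hp1, ?_, hg⟩, hcp⟩
          have hm1 : ¬ p ∣ m' := fun h1 => hcp ((h1.mul_right n').mul_left _)
          have hn1 : ¬ p ∣ n' := fun h1 => hcp ((h1.mul_left m').mul_left _)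
          rw [hp1.dvd_mul, hp1.dvd_mul, hp1.dvd_mul] at hp2
          tauto
      · intro p hp
        simp only [mem_union, mem_filter, Nat.mem_primeFactors] at hp
        have : p.Prime := by tauto
        exact (pf_pos this).le
      · intro p _ _
        exact pf_le
    · rw [Finset.disjoint_left]
      intro p h1 h2
      simp only [mem_filter, Nat.mem_primeFactors] at h1 h2
      tauto
  have h7 : rho g * rho (g * m' * (g * n')) = rho (g * m') * rho (g * n') := by
    have e : g.primeFactors = (g * m').primeFactors ∩ (g * n').primeFactors := by
      rw [← Nat.primeFactors_gcd (by positivity) (by positivity), Nat.gcd_mul_left, hcop, mul_one]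
    unfold rho
    rw [Nat.primeFactors_mul (a := g * m') (by positivity) (by positivity), mul_comm, e,
      Finset.prod_union_inter]
  have r1 := rho_pos (m' * n')
  have r2 := rho_pos c.natAbs
  have r3 := rho_pos g
  rw [← div_eq_mul_inv, div_div, le_div_iff₀ (by positivity)]
  calc _ ≤ g * (rho g * Q) * (rho (m' * n') * rho c.natAbs) := by gcongr
    _ = g * rho g * (Q * (rho c.natAbs * rho (m' * n'))) := by ring
    _ ≤ g * rho g * rho (g * m' * (g * n')) := by gcongr
    _ = _ := by rw [mul_assoc, h7, mul_assoc]

lemma totient_rho (n : ℕ) : (n.totient : ℝ) = n * rho n := by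
  have h := Nat.totient_eq_mul_prod_factors n
  have h' : ((n.totient : ℚ) : ℝ) = ((n * ∏ p ∈ n.primeFactors, (1 - (p : ℚ)⁻¹) : ℚ) : ℝ) := by
    rw [h]
  push_cast at h'
  exact h'

lemma card_cop (n : ℕ) : (((Finset.Icc 1 n).filter (fun a => Nat.Coprime a n)).card : ℝ) = n * rho n := by
  rw [← totient_rho]
  congr 1
  rw [← Nat.filter_coprime_Ico_eq_totient n 1]
  congr 1
  ext a
  simp only [mem_filter, mem_Icc, mem_Ico, Nat.coprime_comm (m := n)]
  constructor <;> rintro ⟨h, h'⟩ <;> exact ⟨by omega, h'⟩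

lemma circle_norm_le (x : ℝ) : ‖(x : UnitAddCircle)‖ ≤ |x| := by
  rw [← Real.norm_eq_abs]
  exact QuotientAddGroup.norm_mk_le_norm

lemma circle_eq {x y : ℝ} (h : (x : UnitAddCircle) = y) : ∃ j : ℤ, x - y = j := by
  have h1 : ((x - y : ℝ) : UnitAddCircle) = 0 := by
    rw [AddCircle.coe_sub, h, sub_self]
  obtain ⟨j, hj⟩ := (AddCircle.coe_eq_zero_iff (1 : ℝ)).1 h1
  exact ⟨j, by rw [← hj]; simp⟩

lemma arc_vol (n : ℕ) (a s : ℝ) :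
    volume ((fun y : ℝ => (y : UnitAddCircle)) '' Set.Ioo ((a - s) / n) ((a + s) / n)) ≤
      ENNReal.ofReal (2 * (s / n)) := by
  have hsub : (fun y : ℝ => (y : UnitAddCircle)) '' Set.Ioo ((a - s) / n) ((a + s) / n) ⊆
      Metric.closedBall ((a / n : ℝ) : UnitAddCircle) (s / n) := by
    rintro _ ⟨y, hy, rfl⟩
    rw [Metric.mem_closedBall, dist_eq_norm]
    have : ((y : ℝ) : UnitAddCircle) - ((a / n : ℝ) : UnitAddCircle) = ((y - a / n : ℝ) : UnitAddCircle) := by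
      rw [AddCircle.coe_sub]
    rw [this]
    refine (circle_norm_le _).trans ?_
    rw [sub_div, add_div] at hy
    rw [abs_le]
    constructor <;> linarith [hy.1, hy.2]
  refine (measure_mono hsub).trans ?_
  rw [AddCircle.volume_closedBall]
  exact ENNReal.ofReal_le_ofReal (min_le_right _ _)

lemma E_open (ψ : ℕ → ℝ) (n : ℕ) : IsOpen (E ψ n) := by
  unfold E
  refine isOpen_biUnion fun a _ => ?_
  exact QuotientAddGroup.isOpenMap_coe _ isOpen_Ioo

lemma E_lower (ψ : ℕ → ℝ) (n : ℕ) (hn : n ≠ 0) (h0 : 0 ≤ ψ n) (h1 : ψ n ≤ 1 / 2) :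
    2 * ψ n * rho n ≤ (volume (E ψ n)).toReal := by
  have hn0 : (0 : ℝ) < n := by exact_mod_cast Nat.pos_of_ne_zero hn
  have hfin : volume (E ψ n) ≠ ⊤ := measure_ne_top _ _
  rw [← ENNReal.ofReal_le_iff_le_toReal hfin]
  have hp := UnitAddCircle.measurePreserving_mk (1 / (2 * n) : ℝ)
  rw [← hp.measure_preimage (E_open ψ n).measurableSet.nullMeasurableSet,
    Measure.restrict_apply (hp.measurable (E_open ψ n).measurableSet)]
  have hsub : (⋃ a ∈ (Finset.Icc 1 n).filter (fun a => Nat.Coprime a n),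
      Set.Ioo (((a : ℝ) - ψ n) / n) (((a : ℝ) + ψ n) / n)) ⊆
      QuotientAddGroup.mk ⁻¹' (E ψ n) ∩ Set.Ioc (1 / (2 * n) : ℝ) (1 / (2 * n) + 1) := by
    intro y hy
    simp only [Set.mem_iUnion] at hy
    obtain ⟨a, ha, hy⟩ := hy
    refine ⟨?_, ?_⟩
    · simp only [E, Set.mem_preimage, Set.mem_iUnion]
      exact ⟨a, ha, y, hy, rfl⟩
    · simp only [mem_filter, mem_Icc] at ha
      have a1 : (1 : ℝ) ≤ a := by exact_mod_cast ha.1.1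
      have a2 : (a : ℝ) ≤ n := by exact_mod_cast ha.1.2
      constructor
      · refine lt_of_le_of_lt ?_ hy.1
        rw [div_le_div_iff₀ (by positivity) hn0]
        nlinarith
      · refine hy.2.le.trans ?_
        have : (1 / (2 * n) + 1 : ℝ) = (n + 1 / 2) / n := by field_simp; ring
        rw [this]
        gcongr
  refine le_trans ?_ (measure_mono hsub)
  rw [measure_biUnion_finset]
  · simp only [Real.volume_Ioo]
    have : ∀ a : ℕ, ((a : ℝ) + ψ n) / n - ((a : ℝ) - ψ n) / n = 2 * ψ n / n := by
      intro a; ring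
    simp only [this]
    rw [Finset.sum_const, nsmul_eq_mul, ← ENNReal.ofReal_natCast,
      ← ENNReal.ofReal_mul (by positivity), card_cop]
    apply ENNReal.ofReal_le_ofReal
    apply le_of_eq
    field_simp
  · intro a _ b _ hab
    simp only [Function.onFun]
    rw [Set.disjoint_left]
    intro y h1y h2y
    have e1 := h1y.1
    have e2 := h1y.2
    have e3 := h2y.1
    have e4 := h2y.2
    rw [div_lt_iff₀ hn0] at e1 e3
    rw [lt_div_iff₀ hn0] at e2 e4
    have c1 : (a : ℝ) < b + 1 := by linarith
    have c2 : (b : ℝ) < a + 1 := by linarith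
    have c1' : a < b + 1 := by exact_mod_cast c1
    have c2' : b < a + 1 := by exact_mod_cast c2
    omega
  · intro a _; exact measurableSet_Ioo

lemma E_upper (ψ : ℕ → ℝ) (h0 : ∀ j, 0 ≤ ψ j) (g m' n' : ℕ) (hg : g ≠ 0) (hm : m' ≠ 0) (hn : n' ≠ 0)
    (hcop : Nat.Coprime m' n') (hN : m' * n' ≠ 1) :
    (volume (E ψ (g * m') ∩ E ψ (g * n'))).toReal ≤
      2 * (2 * ψ (g * m') * rho (g * m')) * (2 * ψ (g * n') * rho (g * n')) *
        RR (m' * n') (2 * (g * m' * n') *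
          max (ψ (g * m') / (g * m' : ℕ)) (ψ (g * n') / (g * n' : ℕ))) := by
  set δ₁ := ψ (g * m') / (g * m' : ℕ) with hδ₁
  set δ₂ := ψ (g * n') / (g * n' : ℕ) with hδ₂
  set Y := 2 * (g * m' * n' : ℝ) * max δ₁ δ₂ with hY
  have g0 : (0 : ℝ) < g := by exact_mod_cast Nat.pos_of_ne_zero hg
  have m0 : (0 : ℝ) < m' := by exact_mod_cast Nat.pos_of_ne_zero hm
  have n0 : (0 : ℝ) < n' := by exact_mod_cast Nat.pos_of_ne_zero hn
  by_cases hz : ψ (g * m') = 0 ∨ ψ (g * n') = 0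
  · have : E ψ (g * m') ∩ E ψ (g * n') = ∅ := by
      rcases hz with hz | hz <;> simp [E, hz]
    rw [this]
    rcases hz with hz | hz <;> simp [hz]
  push Not at hz
  have p1 : 0 < ψ (g * m') := lt_of_le_of_ne (h0 _) (Ne.symm hz.1)
  have p2 : 0 < ψ (g * n') := lt_of_le_of_ne (h0 _) (Ne.symm hz.2)
  have d1 : 0 < δ₁ := by rw [hδ₁]; push_cast; positivity
  have d2 : 0 < δ₂ := by rw [hδ₂]; push_cast; positivity
  have dm : 0 < max δ₁ δ₂ := lt_max_of_lt_left d1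
  have hYpos : 0 < Y := by rw [hY]; positivity
  set A : ℕ × ℕ → Set UnitAddCircle := fun x =>
    ((fun y : ℝ => (y : UnitAddCircle)) '' Set.Ioo (((x.1 : ℝ) - ψ (g * m')) / (g * m' : ℕ)) (((x.1 : ℝ) + ψ (g * m')) / (g * m' : ℕ))) ∩
    ((fun y : ℝ => (y : UnitAddCircle)) '' Set.Ioo (((x.2 : ℝ) - ψ (g * n')) / (g * n' : ℕ)) (((x.2 : ℝ) + ψ (g * n')) / (g * n' : ℕ))) with hA
  have hAv : ∀ x, volume (A x) ≤ ENNReal.ofReal (2 * min δ₁ δ₂) := by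
    intro x
    have e1 := (measure_mono (Set.inter_subset_left (s := _) (t := _))).trans (arc_vol (g * m') x.1 (ψ (g * m')))
      |>.trans' (le_refl (volume (A x)))
    have e2 := (measure_mono (Set.inter_subset_right (s := _) (t := _))).trans (arc_vol (g * n') x.2 (ψ (g * n')))
      |>.trans' (le_refl (volume (A x)))
    rcases min_choice δ₁ δ₂ with h | h <;> rw [h]
    · exact e1
    · exact e2
  set T : ℤ → Finset (ℕ × ℕ) := fun c => SS (g * m') (g * n') m' n' c with hT
  have hcover : E ψ (g * m') ∩ E ψ (g * n') ⊆
      ⋃ k ∈ Ioc 0 ⌊Y⌋₊, ⋃ x ∈ (T (k : ℕ)) ∪ (T (-(k : ℕ))), A x := by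
    rintro z ⟨hz1, hz2⟩
    simp only [E, Set.mem_iUnion] at hz1 hz2
    obtain ⟨a, ha, hza⟩ := hz1
    obtain ⟨b, hb, hzb⟩ := hz2
    have hzA : z ∈ A (a, b) := ⟨hza, hzb⟩
    obtain ⟨y1, hy1, rfl⟩ := hza
    obtain ⟨y2, hy2, hy⟩ := hzb
    obtain ⟨j, hj⟩ := circle_eq hy.symm
    set c : ℤ := a * n' - b * m' - j * (g * m' * n') with hc
    have hcS : (a, b) ∈ T c := by
      simp only [hT, SS, mem_filter, mem_product]
      exact ⟨⟨by simpa using ha, by simpa using hb⟩, ⟨j, by rw [hc]; push_cast; ring⟩⟩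
    have hc0 : c ≠ 0 := by
      intro h
      have := SS_coprime hcop hcS
      rw [h] at this
      simp at this
      exact hN (by simp [this])
    have hcY : |(c : ℝ)| ≤ Y := by
      have hce : (c : ℝ) = g * m' * n' * ((a : ℝ) / (g * m' : ℕ) - y1) - g * m' * n' * ((b : ℝ) / (g * n' : ℕ) - y2) := by
        have : (c : ℝ) = a * n' - b * m' - (y1 - y2) * (g * m' * n') := by
          rw [hj, hc]; push_cast; ring
        rw [this]
        push_cast
        field_simp
        ring
      have b1 : |(a : ℝ) / (g * m' : ℕ) - y1| ≤ max δ₁ δ₂ := by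
        rw [sub_div, add_div] at hy1
        refine le_trans ?_ (le_max_left _ _)
        rw [abs_le]; constructor <;> linarith [hy1.1, hy1.2]
      have b2 : |(b : ℝ) / (g * n' : ℕ) - y2| ≤ max δ₁ δ₂ := by
        rw [sub_div, add_div] at hy2
        refine le_trans ?_ (le_max_right _ _)
        rw [abs_le]; constructor <;> linarith [hy2.1, hy2.2]
      rw [hce, ← mul_sub, abs_mul, abs_of_pos (by positivity : (0:ℝ) < g * m' * n'), hY]
      have := (abs_sub ((a : ℝ) / (g * m' : ℕ) - y1) ((b : ℝ) / (g * n' : ℕ) - y2))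
      calc _ ≤ (g * m' * n' : ℝ) * (max δ₁ δ₂ + max δ₁ δ₂) := by
            gcongr; linarith
        _ = _ := by ring
    have hcabs : c.natAbs ∈ Ioc 0 ⌊Y⌋₊ := by
      rw [mem_Ioc]
      refine ⟨Int.natAbs_pos.2 hc0, Nat.le_floor ?_⟩
      rw [Nat.cast_natAbs, Int.cast_abs]
      exact hcY
    refine Set.mem_biUnion hcabs (Set.mem_biUnion (x := (a, b)) ?_ hzA)
    rw [SetLike.mem_coe, mem_union]
    rcases Int.natAbs_eq c with h | h
    · left; rw [← h]; exact hcS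
    · right; rw [← h]; exact hcS
  have hr1 := rho_pos (g * m')
  have hr2 := rho_pos (g * n')
  have hr3 := rho_pos (m' * n')
  have hmin : 0 < min δ₁ δ₂ := lt_min d1 d2
  set Z : ℝ := g * rho (g * m') * rho (g * n') / rho (m' * n') with hZ
  have hZ0 : 0 ≤ Z := by rw [hZ]; positivity
  have hvol : volume (E ψ (g * m') ∩ E ψ (g * n')) ≤
      ENNReal.ofReal (∑ k ∈ Ioc 0 ⌊Y⌋₊, (2 * if k.Coprime (m' * n') then Z * (rho k)⁻¹ else 0) * (2 * min δ₁ δ₂)) := by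
    refine (measure_mono hcover).trans ((measure_biUnion_finset_le _ _).trans ?_)
    rw [ENNReal.ofReal_sum_of_nonneg]
    · apply Finset.sum_le_sum
      intro k hk
      rw [mem_Ioc] at hk
      refine (measure_biUnion_finset_le _ _).trans ?_
      refine (Finset.sum_le_sum (fun x _ => hAv x)).trans ?_
      rw [Finset.sum_const, nsmul_eq_mul, ← ENNReal.ofReal_natCast, ← ENNReal.ofReal_mul (by positivity)]
      apply ENNReal.ofReal_le_ofReal
      apply mul_le_mul_of_nonneg_right _ (by positivity)
      have s1 := SS_card (c := (k : ℤ)) hg hm hn (by omega) hcop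
      have s2 := SS_card (c := -(k : ℤ)) hg hm hn (by omega) hcop
      rw [Int.natAbs_neg] at s2
      rw [Int.natAbs_natCast] at s1 s2
      have s3 : ((T (k : ℕ) ∪ T (-(k : ℕ))).card : ℝ) ≤ (T (k : ℕ)).card + (T (-(k : ℕ))).card := by
        exact_mod_cast Finset.card_union_le _ _
      linarith
    · intro k _
      have := rho_pos k
      split_ifs <;> positivity
  have hvol' := ENNReal.toReal_mono ENNReal.ofReal_ne_top hvol
  refine hvol'.trans ?_
  rw [ENNReal.toReal_ofReal]
  swap
  · apply Finset.sum_nonneg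
    intro k _
    have := rho_pos k
    split_ifs <;> positivity
  have hsum : ∑ k ∈ Ioc 0 ⌊Y⌋₊, (2 * if k.Coprime (m' * n') then Z * (rho k)⁻¹ else 0) * (2 * min δ₁ δ₂)
      = 4 * min δ₁ δ₂ * Z * FF (m' * n') ⌊Y⌋₊ := by
    unfold FF
    rw [Finset.sum_filter, Finset.mul_sum]
    apply Finset.sum_congr rfl
    intro k _
    split_ifs <;> ring
  rw [hsum]
  apply le_of_eq
  unfold RR
  have e1 : ψ (g * m') = δ₁ * (g * m') := by rw [hδ₁]; push_cast; field_simp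
  have e2 : ψ (g * n') = δ₂ * (g * n') := by rw [hδ₂]; push_cast; field_simp
  have e3 : δ₁ * δ₂ = min δ₁ δ₂ * max δ₁ δ₂ := (min_mul_max _ _).symm
  rw [e1, e2]
  have e4 : 2 * (2 * (δ₁ * (g * m')) * rho (g * m')) * (2 * (δ₂ * (g * n')) * rho (g * n')) *
      (FF (m' * n') ⌊Y⌋₊ / (rho (m' * n') * Y)) = 8 * (δ₁ * δ₂) * (g * m') * (g * n') * rho (g * m') * rho (g * n') * (FF (m' * n') ⌊Y⌋₊ / (rho (m' * n') * Y)) := by ring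
  rw [e4, e3, hZ]
  generalize FF (m' * n') ⌊Y⌋₊ = F
  rw [hY]
  field_simp
  ring

/-- Within each block `2^{4^h} ≤ m < n < 2^{4^{h+1}}` there is a scaling factor `e^{-k}`,
`1 ≤ k ≤ K = ⌊ε h log 4⌋`, for which the downscaled sets are quasi-independent on average. -/
theorem good_scaling_exists (ε : ℝ) (hε : 0 < ε) :
    ∃ C : ℝ, 0 < C ∧ ∀ (h : ℕ), 1 ≤ h → 1 ≤ ⌊ε * h * Real.log 4⌋₊ →
      ∀ (ψ : ℕ → ℝ), (∀ j, 0 ≤ ψ j) →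
      (∀ n : ℕ, 2 ^ 4 ^ h ≤ n → n < 2 ^ 4 ^ (h + 1) →
        ψ n = 0 ∨ (1 / (n : ℝ) ≤ ψ n ∧ ψ n ≤ 1 / 2)) →
      ∃ k ∈ Finset.Icc 1 ⌊ε * h * Real.log 4⌋₊,
        ∑ n ∈ Finset.Ico (2 ^ 4 ^ h) (2 ^ 4 ^ (h + 1)), ∑ m ∈ Finset.Ico (2 ^ 4 ^ h) n,
            (volume (E (fun j => ψ j / Real.exp k) m ∩
              E (fun j => ψ j / Real.exp k) n)).toReal ≤
          C * ∑ n ∈ Finset.Ico (2 ^ 4 ^ h) (2 ^ 4 ^ (h + 1)), ∑ m ∈ Finset.Ico (2 ^ 4 ^ h) n,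
            (volume (E (fun j => ψ j / Real.exp k) m)).toReal *
              (volume (E (fun j => ψ j / Real.exp k) n)).toReal := by
  obtain ⟨C1, hC1, hM⟩ := mertens
  obtain ⟨C, hC, havg⟩ := avg hC1 hM ε hε
  refine ⟨2 * C, by positivity, ?_⟩
  intro h hh hK ψ h0 hψ
  have hav := havg h hh hK
  generalize hKK : ⌊ε * h * Real.log 4⌋₊ = K at *
  set lo := 2 ^ 4 ^ h with hlo
  set hi := 2 ^ 4 ^ (h + 1) with hhi
  have hlo0 : 0 < lo := by rw [hlo]; positivity
  set μ : ℕ → ℝ := fun n => 2 * ψ n * rho n with hμ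
  have hμ0 : ∀ n, 0 ≤ μ n := fun n => by
    have := rho_pos n
    have := h0 n
    simp only [hμ]; positivity
  have hhalf : ∀ n, lo ≤ n → n < hi → ψ n ≤ 1 / 2 := by
    intro n h1 h2
    rcases hψ n h1 h2 with h | h
    · rw [h]; norm_num
    · exact h.2
  -- pairwise bound
  have pair : ∀ n ∈ Ico lo hi, ∀ m ∈ Ico lo n,
      ∑ k ∈ Icc 1 K, Real.exp k ^ 2 * (volume (E (fun j => ψ j / Real.exp k) m ∩
              E (fun j => ψ j / Real.exp k) n)).toReal ≤ 2 * C * (μ m * μ n) * K := by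
    intro n hn m hm
    rw [mem_Ico] at hn hm
    obtain ⟨g, m', n', hg0, hcop, hme, hne⟩ := Nat.exists_coprime' (m := m) (n := n)
      (Nat.gcd_pos_of_pos_left _ (by omega))
    rw [mul_comm] at hme hne
    subst hme hne
    have hm' : m' ≠ 0 := by rintro rfl; simp at hm; omega
    have hn' : n' ≠ 0 := by rintro rfl; simp at hn; omega
    have hN1 : m' * n' ≠ 1 := by
      intro h1
      rw [_root_.mul_eq_one] at h1
      rw [h1.1, h1.2] at hm
      omega
    have hNlt : m' * n' < 2 ^ (8 * 4 ^ h) := by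
      have a1 : m' ≤ g * m' := Nat.le_mul_of_pos_left _ hg0
      have a2 : n' ≤ g * n' := Nat.le_mul_of_pos_left _ hg0
      have a3 : m' < hi := by omega
      have a4 : n' < hi := by omega
      have a5 : hi * hi = 2 ^ (8 * 4 ^ h) := by
        rw [hhi, ← pow_add]; congr 1; ring
      rw [← a5]
      exact Nat.mul_lt_mul'' a3 a4
    set Y : ℝ := 2 * (g * m' * n') *
          max (ψ (g * m') / (g * m' : ℕ)) (ψ (g * n') / (g * n' : ℕ)) with hY
    have step : ∀ k ∈ Icc 1 K, Real.exp k ^ 2 * (volume (E (fun j => ψ j / Real.exp k) (g * m') ∩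
              E (fun j => ψ j / Real.exp k) (g * n'))).toReal ≤
              2 * (μ (g * m') * μ (g * n')) * RR (m' * n') (Y / Real.exp k) := by
      intro k _
      have he := Real.exp_pos (k : ℝ)
      have hu := E_upper (fun j => ψ j / Real.exp k) (fun j => div_nonneg (h0 j) he.le) g m' n'
        hg0.ne' hm' hn' hcop hN1
      have hYk : 2 * (g * m' * n' : ℝ) * max (ψ (g * m') / Real.exp k / (g * m' : ℕ))
          (ψ (g * n') / Real.exp k / (g * n' : ℕ)) = Y / Real.exp k := by
        rw [hY, div_right_comm, div_right_comm (ψ (g * n')), max_div_div_right he.le, mul_div_assoc]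
      rw [hYk] at hu
      refine (mul_le_mul_of_nonneg_left hu (by positivity)).trans (le_of_eq ?_)
      simp only [hμ]
      field_simp
    refine (Finset.sum_le_sum step).trans ?_
    rw [← Finset.mul_sum]
    by_cases hYp : 0 < Y
    · have := hav (m' * n') (by positivity) hNlt Y hYp
      have hmm := mul_nonneg (hμ0 (g * m')) (hμ0 (g * n'))
      calc _ ≤ 2 * (μ (g * m') * μ (g * n')) * (C * K) := by gcongr
        _ = _ := by ring
    · have hz : ψ (g * m') = 0 := by
        by_contra hne
        have hpos : 0 < ψ (g * m') := lt_of_le_of_ne (h0 _) (Ne.symm hne)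
        apply hYp
        rw [hY]
        have g0 : (0 : ℝ) < g := by exact_mod_cast hg0
        have m0 : (0 : ℝ) < m' := by exact_mod_cast Nat.pos_of_ne_zero hm'
        have n0 : (0 : ℝ) < n' := by exact_mod_cast Nat.pos_of_ne_zero hn'
        have : 0 < max (ψ (g * m') / (g * m' : ℕ)) (ψ (g * n') / (g * n' : ℕ)) :=
          lt_max_of_lt_left (by push_cast; positivity)
        positivity
      have : μ (g * m') = 0 := by simp [hμ, hz]
      rw [this]; simp
  set T := ∑ n ∈ Ico lo hi, ∑ m ∈ Ico lo n, μ m * μ n with hT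
  have tot : ∑ k ∈ Icc 1 K, Real.exp k ^ 2 * (∑ n ∈ Ico lo hi, ∑ m ∈ Ico lo n,
      (volume (E (fun j => ψ j / Real.exp k) m ∩ E (fun j => ψ j / Real.exp k) n)).toReal) ≤
      ∑ k ∈ Icc 1 K, 2 * C * T := by
    have e : ∑ k ∈ Icc 1 K, 2 * C * T = ∑ n ∈ Ico lo hi, ∑ m ∈ Ico lo n, 2 * C * (μ m * μ n) * K := by
      rw [Finset.sum_const, Nat.card_Icc, nsmul_eq_mul, hT]
      simp only [← Finset.mul_sum, ← Finset.sum_mul]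
      rw [Nat.add_sub_cancel]
      ring
    rw [e]
    simp only [Finset.mul_sum]
    rw [Finset.sum_comm]
    apply Finset.sum_le_sum
    intro n hn
    rw [Finset.sum_comm]
    exact Finset.sum_le_sum (fun m hm => pair n hn m hm)
  obtain ⟨k, hk, hkle⟩ := Finset.exists_le_of_sum_le (Finset.nonempty_Icc.2 hK) tot
  refine ⟨k, hk, ?_⟩
  have he := Real.exp_pos (k : ℝ)
  have he1 : 1 ≤ Real.exp (k : ℝ) := Real.one_le_exp (by positivity)
  have lower : T ≤ Real.exp k ^ 2 * ∑ n ∈ Ico lo hi, ∑ m ∈ Ico lo n,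
            (volume (E (fun j => ψ j / Real.exp k) m)).toReal *
              (volume (E (fun j => ψ j / Real.exp k) n)).toReal := by
    rw [hT]
    simp only [Finset.mul_sum]
    have one : ∀ n, lo ≤ n → n < hi → μ n ≤ Real.exp k * (volume (E (fun j => ψ j / Real.exp k) n)).toReal := by
      intro n h1 h2
      have := E_lower (fun j => ψ j / Real.exp k) n (by omega) (div_nonneg (h0 n) he.le)
        ((div_le_self (h0 n) he1).trans (hhalf n h1 h2))
      refine le_trans (le_of_eq ?_) (mul_le_mul_of_nonneg_left this he.le)
      simp only [hμ]
      field_simp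
    apply Finset.sum_le_sum
    intro n hn
    apply Finset.sum_le_sum
    intro m hm
    rw [mem_Ico] at hn hm
    calc μ m * μ n ≤ (Real.exp k * (volume (E (fun j => ψ j / Real.exp k) m)).toReal) *
          (Real.exp k * (volume (E (fun j => ψ j / Real.exp k) n)).toReal) :=
          mul_le_mul (one m hm.1 (by omega)) (one n hn.1 hn.2) (hμ0 n) (by positivity)
      _ = _ := by ring
  have fin := hkle.trans (mul_le_mul_of_nonneg_left lower (by positivity : 0 ≤ 2 * C))
  have hpos : 0 < Real.exp (k : ℝ) ^ 2 := by positivity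
  refine le_of_mul_le_mul_left (fin.trans (le_of_eq ?_)) hpos
  ring
end

section
/- For every ε > 0 there is a constant C = C(ε) > 0 such that for every integer t ≥ 2 and every real number y ≥ 2 with y ≥ (log t)^ε, one has ∑_{1 ≤ b ≤ y, gcd(b,t)=1} 1/b ≤ C·(log y)·φ(t)/t. -/
open Finset

lemma aux_pow_dvd (p : ℕ) (hp : 0 < p) (k : ℕ) : p ^ k ∣ (p * k).factorial := by
  induction k with
  | zero => simp
  | succ k ih =>
    have h1 : p * (k+1) = (p * (k+1) - 1) + 1 := by
      have : 0 < p * (k+1) := by positivity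
      omega
    rw [h1, Nat.factorial_succ, ← h1, pow_succ, mul_comm]
    apply Nat.mul_dvd_mul (Dvd.intro _ rfl)
    refine ih.trans (Nat.factorial_dvd_factorial ?_)
    rw [mul_add, mul_one]; omega

lemma aux_mertens (n : ℕ) (hn : 1 ≤ n) :
    ∑ p ∈ Nat.primesLE n, Real.log p / p ≤ Real.log n + Real.log 4 := by
  have hprime : ∀ p ∈ Nat.primesLE n, p.Prime := fun p hp => (Nat.mem_primesLE.1 hp).2
  have hn0 : (0:ℝ) < n := by exact_mod_cast hn
  have hd : ∏ p ∈ Nat.primesLE n, p ^ (n / p) ∣ n.factorial := by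
    apply Finset.prod_dvd_of_isRelPrime
    · intro p hp q hq hpq
      exact Nat.coprime_iff_isRelPrime.1
        (Nat.Coprime.pow _ _ ((Nat.coprime_primes (hprime p hp) (hprime q hq)).2 hpq))
    · intro p hp
      exact (aux_pow_dvd p (hprime p hp).pos _).trans
        (Nat.factorial_dvd_factorial (Nat.mul_div_le n p))
  have hle : ∏ p ∈ Nat.primesLE n, p ^ (n / p) ≤ n ^ n :=
    (Nat.le_of_dvd (Nat.factorial_pos n) hd).trans (Nat.factorial_le_pow n)
  have hlog : ∑ p ∈ Nat.primesLE n, ((n / p : ℕ) : ℝ) * Real.log p ≤ n * Real.log n := by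
    have h : Real.log ((∏ p ∈ Nat.primesLE n, p ^ (n / p) : ℕ) : ℝ) ≤ Real.log ((n ^ n : ℕ) : ℝ) := by
      apply Real.log_le_log
      · have : 0 < ∏ p ∈ Nat.primesLE n, p ^ (n / p) :=
          Finset.prod_pos fun p hp => pow_pos (hprime p hp).pos _
        exact_mod_cast this
      · exact_mod_cast hle
    push_cast at h
    rw [Real.log_prod, Real.log_pow] at h
    · simpa [Real.log_pow] using h
    · intro p hp
      have := (hprime p hp).pos
      positivity
  have hth : ∑ p ∈ Nat.primesLE n, Real.log p ≤ Real.log 4 * n := by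
    rw [← Chebyshev.theta_eq_sum_primesLE_log]
    exact Chebyshev.theta_le_log4_mul_x hn0.le
  have hmain : (n:ℝ) * ∑ p ∈ Nat.primesLE n, Real.log p / p ≤
      ∑ p ∈ Nat.primesLE n, ((n / p : ℕ) : ℝ) * Real.log p + ∑ p ∈ Nat.primesLE n, Real.log p := by
    rw [Finset.mul_sum, ← Finset.sum_add_distrib]
    apply Finset.sum_le_sum
    intro p hp
    have hp0 : (0:ℝ) < p := by exact_mod_cast (hprime p hp).pos
    have hl : 0 ≤ Real.log p := Real.log_natCast_nonneg p
    have h1 : (n:ℝ) / p ≤ ((n / p : ℕ) : ℝ) + 1 := by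
      rw [← Nat.floor_div_eq_div (K := ℝ)]
      exact (Nat.lt_floor_add_one _).le
    calc (n:ℝ) * (Real.log p / p) = (n / p) * Real.log p := by ring
      _ ≤ (((n / p : ℕ) : ℝ) + 1) * Real.log p := by gcongr
      _ = _ := by ring
  have : (n:ℝ) * ∑ p ∈ Nat.primesLE n, Real.log p / p ≤ n * (Real.log n + Real.log 4) := by
    linarith
  exact le_of_mul_le_mul_left this hn0

lemma aux_B (t : ℕ) (ht : 2 ≤ t) :
    ∑ p ∈ t.primeFactors, Real.log p / p ≤ Real.log (flog t) + 3 := by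
  set L := flog t with hL
  have hL1 : 1 ≤ L := le_max_left _ _
  have hLt : Real.log t ≤ L := le_max_right _ _
  have hn : 1 ≤ ⌊L⌋₊ := Nat.one_le_floor_iff _ |>.2 hL1
  have hfl : (⌊L⌋₊ : ℝ) ≤ L := Nat.floor_le (by linarith)
  have h4 : Real.log 4 ≤ 2 := by
    have : Real.log 4 = 2 * Real.log 2 := by
      rw [show (4:ℝ) = 2 ^ 2 by norm_num, Real.log_pow]; norm_num
    linarith [Real.log_two_lt_d9]
  rw [← Finset.sum_filter_add_sum_filter_not t.primeFactors (fun p => p ≤ ⌊L⌋₊)]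
  have h1 : ∑ p ∈ t.primeFactors with p ≤ ⌊L⌋₊, Real.log p / p ≤ Real.log L + 2 := by
    calc _ ≤ ∑ p ∈ Nat.primesLE ⌊L⌋₊, Real.log p / p := by
          apply Finset.sum_le_sum_of_subset_of_nonneg
          · intro p hp
            rw [Finset.mem_filter] at hp
            exact Nat.mem_primesLE.2 ⟨hp.2, Nat.prime_of_mem_primeFactors hp.1⟩
          · intro p _ _
            exact div_nonneg (Real.log_natCast_nonneg p) (Nat.cast_nonneg _)
      _ ≤ _ := aux_mertens _ hn
      _ ≤ _ := by
          have : Real.log (⌊L⌋₊ : ℝ) ≤ Real.log L :=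
            Real.log_le_log (by exact_mod_cast hn) hfl
          linarith
  have h2 : ∑ p ∈ t.primeFactors with ¬ p ≤ ⌊L⌋₊, Real.log p / p ≤ 1 := by
    calc _ ≤ ∑ p ∈ t.primeFactors with ¬ p ≤ ⌊L⌋₊, Real.log p / L := by
          apply Finset.sum_le_sum
          intro p hp
          rw [Finset.mem_filter] at hp
          have : L < p := (Nat.floor_lt (by linarith)).1 (by omega)
          have := Real.log_natCast_nonneg p
          gcongr
      _ ≤ ∑ p ∈ t.primeFactors, Real.log p / L := by
          apply Finset.sum_le_sum_of_subset_of_nonneg (Finset.filter_subset _ _)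
          intro p _ _
          exact div_nonneg (Real.log_natCast_nonneg p) (by linarith)
      _ = Real.log ((∏ p ∈ t.primeFactors, p : ℕ) : ℝ) / L := by
          rw [← Finset.sum_div]; push_cast
          rw [Real.log_prod]
          intro p hp
          exact_mod_cast (Nat.prime_of_mem_primeFactors hp).ne_zero
      _ ≤ Real.log t / L := by
          have h0 : 0 < ∏ p ∈ t.primeFactors, p :=
            Finset.prod_pos fun p hp => (Nat.prime_of_mem_primeFactors hp).pos
          have := Nat.le_of_dvd (by omega) (Nat.prod_primeFactors_dvd t)
          gcongr
      _ ≤ 1 := (div_le_one (by linarith)).2 hLt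
  linarith

lemma aux_F (P : Finset ℕ) :
    ∑ s ∈ P.powerset, (∑ p ∈ s, Real.log p) * ∏ p ∈ s, (1:ℝ) / p ≤
      (∑ p ∈ P, Real.log p / p) * ∑ s ∈ P.powerset, ∏ p ∈ s, (1:ℝ) / p := by
  induction P using Finset.induction_on with
  | empty => simp
  | insert a P ha ih =>
    rw [Finset.sum_powerset_insert ha, Finset.sum_powerset_insert ha, Finset.sum_insert ha]
    have e1 : ∑ s ∈ P.powerset, (∑ p ∈ insert a s, Real.log p) * ∏ p ∈ insert a s, (1:ℝ) / p =
        Real.log a / a * ∑ s ∈ P.powerset, ∏ p ∈ s, (1:ℝ) / p +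
        1 / a * ∑ s ∈ P.powerset, (∑ p ∈ s, Real.log p) * ∏ p ∈ s, (1:ℝ) / p := by
      rw [Finset.mul_sum, Finset.mul_sum, ← Finset.sum_add_distrib]
      apply Finset.sum_congr rfl
      intro s hs
      have : a ∉ s := fun h => ha (Finset.mem_powerset.1 hs h)
      rw [Finset.sum_insert this, Finset.prod_insert this]; ring
    have e2 : ∑ s ∈ P.powerset, ∏ p ∈ insert a s, (1:ℝ) / p =
        1 / a * ∑ s ∈ P.powerset, ∏ p ∈ s, (1:ℝ) / p := by
      rw [Finset.mul_sum]
      apply Finset.sum_congr rfl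
      intro s hs
      have : a ∉ s := fun h => ha (Finset.mem_powerset.1 hs h)
      rw [Finset.prod_insert this]
    rw [e1, e2]
    set D := ∑ s ∈ P.powerset, ∏ p ∈ s, (1:ℝ) / p
    set F := ∑ s ∈ P.powerset, (∑ p ∈ s, Real.log p) * ∏ p ∈ s, (1:ℝ) / p
    set B := ∑ p ∈ P, Real.log p / p
    have hD : 0 ≤ D := Finset.sum_nonneg fun s _ => Finset.prod_nonneg fun p _ => by positivity
    have hw : (0:ℝ) ≤ 1 / a := by positivity
    have hl : 0 ≤ Real.log a / a := div_nonneg (Real.log_natCast_nonneg a) (Nat.cast_nonneg _)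
    nlinarith [mul_nonneg hw hD, mul_nonneg hl (mul_nonneg hw hD), mul_le_mul_of_nonneg_left ih hw]

lemma aux_half (P : Finset ℕ) (hP : ∀ p ∈ P, 2 ≤ p) :
    (1:ℝ) / 2 ≤ ∏ p ∈ P, (1 - 1 / (p:ℝ) ^ 2) := by
  have hfac : ∀ p : ℕ, 2 ≤ p → 0 ≤ 1 - 1 / (p:ℝ)^2 ∧ 1 - 1 / (p:ℝ)^2 ≤ 1 := by
    intro p hp
    have hp' : (2:ℝ) ≤ p := by exact_mod_cast hp
    have h1 : 1 / (p:ℝ)^2 ≤ 1 := by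
      rw [div_le_one (by positivity)]; nlinarith
    have h2 : 0 ≤ 1 / (p:ℝ)^2 := by positivity
    constructor <;> linarith
  have tel : ∀ N : ℕ, 1 ≤ N →
      ∏ p ∈ Finset.Icc 2 N, (1 - 1 / (p:ℝ) ^ 2) = ((N:ℝ) + 1) / (2 * (N:ℝ)) := by
    intro N hN
    induction N, hN using Nat.le_induction with
    | base => norm_num
    | succ n hn ih =>
      have : (0:ℝ) < n := by exact_mod_cast hn
      rw [Finset.prod_Icc_succ_top (by omega), ih]
      push_cast
      field_simp
      ring
  set N := P.sup id + 1
  have hsub : P ⊆ Finset.Icc 2 N := by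
    intro p hp
    have : p ≤ P.sup id := Finset.le_sup (f := id) hp
    exact Finset.mem_Icc.2 ⟨hP p hp, by omega⟩
  have hN : (0:ℝ) < N := by positivity
  calc (1:ℝ)/2 ≤ (N + 1) / (2 * N) := by
        rw [div_le_div_iff₀ (by norm_num) (by positivity)]; linarith
    _ = ∏ p ∈ Finset.Icc 2 N, (1 - 1 / (p:ℝ) ^ 2) := (tel N (by omega)).symm
    _ ≤ _ := by
      rw [← Finset.prod_sdiff hsub]
      apply mul_le_of_le_one_left
      · exact Finset.prod_nonneg fun p hp => (hfac p (hP p hp)).1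
      · apply Finset.prod_le_one
        · intro p hp
          exact (hfac p (Finset.mem_Icc.1 (Finset.mem_sdiff.1 hp).1).1).1
        · intro p hp
          exact (hfac p (Finset.mem_Icc.1 (Finset.mem_sdiff.1 hp).1).1).2

lemma aux_phi (t : ℕ) (ht : 2 ≤ t) :
    (1:ℝ) / 2 ≤ (Nat.totient t : ℝ) / t * ∑ s ∈ t.primeFactors.powerset, ∏ p ∈ s, (1:ℝ) / p := by
  have ht0 : (t:ℝ) ≠ 0 := by positivity
  have h1 : (Nat.totient t : ℝ) / t = ∏ p ∈ t.primeFactors, (1 - 1 / (p:ℝ)) := by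
    have := Nat.totient_eq_mul_prod_factors t
    have h2 : (Nat.totient t : ℝ) = t * ∏ p ∈ t.primeFactors, (1 - (p:ℝ)⁻¹) := by
      have h3 := congrArg (fun q : ℚ => (q:ℝ)) this
      push_cast at h3
      exact h3
    rw [h2, mul_div_cancel_left₀ _ ht0]
    simp
  rw [h1, ← Finset.prod_one_add, ← Finset.prod_mul_distrib]
  refine (aux_half t.primeFactors fun p hp => (Nat.prime_of_mem_primeFactors hp).two_le).trans_eq ?_
  apply Finset.prod_congr rfl
  intro p _
  ring

lemma aux_conv (t : ℕ) (y Y : ℝ) (hy : 1 ≤ y) (hY : 1 ≤ Y) :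
    (∑ b ∈ (Finset.Icc 1 ⌊y⌋₊).filter (fun b => Nat.Coprime b t), (1 : ℝ) / b) *
      (∑ s ∈ t.primeFactors.powerset with ((∏ p ∈ s, p : ℕ) : ℝ) ≤ Y, ∏ p ∈ s, (1:ℝ) / p) ≤
    1 + Real.log (y * Y) := by
  rw [Finset.sum_mul_sum, ← Finset.sum_product']
  set S := ((Finset.Icc 1 ⌊y⌋₊).filter (fun b => Nat.Coprime b t)) ×ˢ
    (t.primeFactors.powerset.filter (fun s => ((∏ p ∈ s, p : ℕ) : ℝ) ≤ Y)) with hS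
  have hmem : ∀ x ∈ S, (1 ≤ x.1 ∧ x.1 ≤ ⌊y⌋₊) ∧ Nat.Coprime x.1 t ∧
      x.2 ⊆ t.primeFactors ∧ ((∏ p ∈ x.2, p : ℕ) : ℝ) ≤ Y := by
    intro x hx
    simp only [hS, Finset.mem_product, Finset.mem_filter, Finset.mem_Icc, Finset.mem_powerset] at hx
    exact ⟨hx.1.1, hx.1.2, hx.2.1, hx.2.2⟩
  have hrec : ∀ x ∈ S, x.2 = t.primeFactors.filter (fun p => p ∣ x.1 * ∏ q ∈ x.2, q) := by
    intro x hx
    obtain ⟨_, hc, hs, _⟩ := hmem x hx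
    ext p
    rw [Finset.mem_filter]
    constructor
    · intro hp
      exact ⟨hs hp, (Finset.dvd_prod_of_mem (fun q => q) hp).trans (Dvd.intro_left _ rfl)⟩
    · rintro ⟨hp, hd⟩
      have hpp := Nat.prime_of_mem_primeFactors hp
      rcases hpp.dvd_mul.1 hd with h | h
      · exact absurd (Nat.eq_one_of_dvd_coprimes hc h (Nat.dvd_of_mem_primeFactors hp)) hpp.ne_one
      · obtain ⟨q, hq, hpq⟩ := (hpp.prime.dvd_finsetProd_iff _).1 h
        rw [(Nat.prime_dvd_prime_iff_eq hpp (Nat.prime_of_mem_primeFactors (hs hq))).1 hpq]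
        exact hq
  have hpos : ∀ x ∈ S, 0 < ∏ p ∈ x.2, p := by
    intro x hx
    exact Finset.prod_pos fun p hp => (Nat.prime_of_mem_primeFactors ((hmem x hx).2.2.1 hp)).pos
  have hinj : Set.InjOn (fun x : ℕ × Finset ℕ => x.1 * ∏ p ∈ x.2, p) (S : Set (ℕ × Finset ℕ)) := by
    intro x hx z hz hxz
    simp only at hxz
    have h2 : x.2 = z.2 := by rw [hrec x hx, hrec z hz, hxz]
    refine Prod.ext ?_ h2
    rw [h2] at hxz
    exact Nat.eq_of_mul_eq_mul_right (hpos z hz) hxz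
  have hN : 1 ≤ y * Y := by nlinarith
  calc _ = ∑ x ∈ S, (1:ℝ) / ((x.1 * ∏ p ∈ x.2, p : ℕ) : ℝ) := by
        apply Finset.sum_congr rfl
        intro x _
        push_cast
        rw [Finset.prod_div_distrib]
        simp [mul_comm]
    _ = ∑ n ∈ S.image (fun x : ℕ × Finset ℕ => x.1 * ∏ p ∈ x.2, p), (1:ℝ) / n :=
        (Finset.sum_image (f := fun n : ℕ => (1:ℝ) / n) hinj).symm
    _ ≤ ∑ n ∈ Finset.Icc 1 ⌊y * Y⌋₊, (1:ℝ) / n := by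
        apply Finset.sum_le_sum_of_subset_of_nonneg
        · intro n hn
          obtain ⟨x, hx, rfl⟩ := Finset.mem_image.1 hn
          obtain ⟨⟨h1, h2⟩, _, _, h3⟩ := hmem x hx
          rw [Finset.mem_Icc]
          refine ⟨Nat.mul_pos h1 (hpos x hx), Nat.le_floor ?_⟩
          rw [Nat.cast_mul]
          have : (x.1:ℝ) ≤ y := (Nat.cast_le.2 h2).trans (Nat.floor_le (by linarith))
          gcongr
        · intro n _ _; positivity
    _ = (harmonic ⌊y * Y⌋₊ : ℝ) := by
        rw [harmonic_eq_sum_Icc]; push_cast; simp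
    _ ≤ _ := harmonic_floor_le_one_add_log _ hN

theorem coprime_harmonic_sum_bound (ε : ℝ) (hε : 0 < ε) :
    ∃ C : ℝ, 0 < C ∧ ∀ (t : ℕ), 2 ≤ t → ∀ (y : ℝ), 2 ≤ y → flog t ^ ε ≤ y →
      ∑ b ∈ (Finset.Icc 1 ⌊y⌋₊).filter (fun b => Nat.Coprime b t), (1 : ℝ) / b ≤
        C * flog y * (Nat.totient t : ℝ) / t := by
  refine ⟨4 * (8 + 2 / ε), by positivity, ?_⟩
  intro t ht y hy hty
  set B := ∑ p ∈ t.primeFactors, Real.log p / p with hB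
  set D := ∑ s ∈ t.primeFactors.powerset, ∏ p ∈ s, (1:ℝ) / p with hD
  set S := ∑ b ∈ (Finset.Icc 1 ⌊y⌋₊).filter (fun b => Nat.Coprime b t), (1 : ℝ) / b with hS
  set DY := ∑ s ∈ t.primeFactors.powerset with ((∏ p ∈ s, p : ℕ) : ℝ) ≤ Real.exp (2 * B),
    ∏ p ∈ s, (1:ℝ) / p with hDY
  have hBpos : 0 < B := by
    apply Finset.sum_pos
    · intro p hp
      have := (Nat.prime_of_mem_primeFactors hp).one_lt
      have h' : (1:ℝ) < p := by exact_mod_cast this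
      exact div_pos (Real.log_pos h') (by linarith)
    · exact Nat.nonempty_primeFactors.2 (by omega)
  have hSnn : 0 ≤ S := Finset.sum_nonneg fun b _ => by positivity
  have hconv := aux_conv t y (Real.exp (2 * B)) (by linarith) (Real.one_le_exp (by linarith))
  rw [Real.log_mul (by linarith) (Real.exp_ne_zero _), Real.log_exp] at hconv
  have hF := aux_F t.primeFactors
  have htail : D ≤ 2 * DY := by
    have hsplit := Finset.sum_filter_add_sum_filter_not t.primeFactors.powerset
      (fun s => ((∏ p ∈ s, p : ℕ) : ℝ) ≤ Real.exp (2 * B)) (fun s => ∏ p ∈ s, (1:ℝ) / p)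
    have ht2 : 2 * B * (∑ s ∈ t.primeFactors.powerset with
        ¬ ((∏ p ∈ s, p : ℕ) : ℝ) ≤ Real.exp (2 * B), ∏ p ∈ s, (1:ℝ) / p) ≤ B * D := by
      refine le_trans ?_ hF
      rw [Finset.mul_sum]
      refine le_trans (Finset.sum_le_sum (g := fun s : Finset ℕ => (∑ p ∈ s, Real.log (p:ℝ)) * ∏ p ∈ s, (1:ℝ) / (p:ℝ)) ?_)
        (Finset.sum_le_sum_of_subset_of_nonneg (Finset.filter_subset _ _) ?_)
      · intro s hs
        rw [Finset.mem_filter, Finset.mem_powerset, not_le] at hs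
        have h0 : ∏ p ∈ s, (1:ℝ) / p ≥ 0 := Finset.prod_nonneg fun p _ => by positivity
        have h1 : 2 * B ≤ ∑ p ∈ s, Real.log p := by
          rw [← Real.log_prod]
          · have h2 := hs.2
            push_cast at h2
            rw [← Real.log_exp (2 * B)]
            exact Real.log_le_log (Real.exp_pos _) h2.le
          · intro p hp
            exact_mod_cast (Nat.prime_of_mem_primeFactors (hs.1 hp)).ne_zero
        exact mul_le_mul_of_nonneg_right h1 h0
      · intro s _ _
        exact mul_nonneg (Finset.sum_nonneg fun p _ => Real.log_natCast_nonneg p)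
          (Finset.prod_nonneg fun p _ => by positivity)
    have ht3 : 2 * (∑ s ∈ t.primeFactors.powerset with
        ¬ ((∏ p ∈ s, p : ℕ) : ℝ) ≤ Real.exp (2 * B), ∏ p ∈ s, (1:ℝ) / p) ≤ D := by
      refine le_of_mul_le_mul_left ?_ hBpos
      linarith
    linarith
  have hphi := aux_phi t ht
  rw [← hD] at hphi
  set f := (Nat.totient t : ℝ) / t with hf
  have hfnn : 0 ≤ f := by positivity
  have hlogB := aux_B t ht
  have hl1 : 1 ≤ flog y := le_max_left _ _
  have hl2 : Real.log y ≤ flog y := le_max_right _ _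
  have hLpos : 0 < flog t := lt_of_lt_of_le one_pos (le_max_left _ _)
  have hll : Real.log (flog t) ≤ Real.log y / ε := by
    rw [le_div_iff₀ hε, mul_comm, ← Real.log_rpow hLpos]
    exact Real.log_le_log (Real.rpow_pos_of_pos hLpos _) hty
  have hdiv : Real.log y / ε ≤ flog y / ε := by gcongr
  have hR : 1 + (Real.log y + 2 * B) ≤ (8 + 2 / ε) * flog y := by
    have : (8 + 2 / ε) * flog y = 8 * flog y + 2 * (flog y / ε) := by ring
    rw [this]; linarith
  have hSD : S * D ≤ 2 * ((8 + 2 / ε) * flog y) := by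
    have := mul_le_mul_of_nonneg_left htail hSnn
    linarith
  calc S ≤ 2 * (f * D) * S := by nlinarith
    _ = 2 * f * (S * D) := by ring
    _ ≤ 2 * f * (2 * ((8 + 2 / ε) * flog y)) := by gcongr
    _ = _ := by rw [hf]; ring
end
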